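/- Let K = ℚ(√−7) be the quadratic field obtained by adjoining to ℚ a root √−7 of X² + 7, and set a₁ = (−√−7 + 11)/8, a₂ = (−√−7 + 11)/16, a₃ = (√−7 + 21)/16, a₄ = (−3√−7 − 31)/128, a₅ = (−√−7 + 3)/8. Let t be a transcendental over K and consider the polynomial p(x) := x²¹·(x − 1)⁷·(x − a₁)³ − t·(x² − 2x + a₂)⁸·(x³ − 2x² + a₃x + a₄)⁴·(x − a₅) of degree 31 in x over K(t). Then the Galois group of p over K(t) is isomorphic to PSL₅(𝔽₂), the projective special linear group of degree 5 over the field with two elements. -/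

import Mathlib

/-!
Statement 5: over `K(t)`, where `K = ℚ(√−7)`, the degenerate three-point-cover polynomial
`p(x) = x²¹(x−1)⁷(x−a₁)³ − t(x²−2x+a₂)⁸(x³−2x²+a₃x+a₄)⁴(x−a₅)`
of degree 31 in `x` has Galois group `PSL₅(𝔽₂)`.
We model `K = ℚ(√−7)` as an arbitrary field `K` equipped with a `ℚ`-algebra structure and an
element `s` with `s² = −7` generating `K` over `ℚ`, and `K(t)` as `RatFunc K` with
`t = RatFunc.X` a transcendental over `K`.
-/

open Polynomial

namespace PSL52Family

section Certificate

/-! ### Bivariate polynomials over `ℤ[√-7]` as lists of coefficients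

A pair `(a, b)` stands for `a + b√-7`, a list of pairs for a polynomial in one variable `y`, and a
list of such lists for a polynomial in `x` over those. -/

/-- The product in `ℤ[√-7]`. -/
def mulPair (c d : ℤ × ℤ) : ℤ × ℤ := (c.1 * d.1 - 7 * (c.2 * d.2), c.1 * d.2 + c.2 * d.1)

/-- The sum of two coefficient lists. -/
def addList : List (ℤ × ℤ) → List (ℤ × ℤ) → List (ℤ × ℤ)
  | [], v => v
  | c :: u, [] => c :: u
  | c :: u, d :: v => (c.1 + d.1, c.2 + d.2) :: addList u v

/-- A constant times a coefficient list. -/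
def smulList (c : ℤ × ℤ) (u : List (ℤ × ℤ)) : List (ℤ × ℤ) := u.map (mulPair c)

/-- The product of two coefficient lists. -/
def mulList (u v : List (ℤ × ℤ)) : List (ℤ × ℤ) :=
  u.foldr (fun c r => addList (smulList c v) ((0, 0) :: r)) []

/-- A power of a coefficient list. -/
def powList (u : List (ℤ × ℤ)) : ℕ → List (ℤ × ℤ)
  | 0 => [(1, 0)]
  | n + 1 => mulList (powList u n) u

/-- The conjugate `√-7 ↦ -√-7` of a coefficient list. -/
def conjList (u : List (ℤ × ℤ)) : List (ℤ × ℤ) := u.map fun c => (c.1, -c.2)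

/-- The sum of two bivariate coefficient lists. -/
def addTable : List (List (ℤ × ℤ)) → List (List (ℤ × ℤ)) → List (List (ℤ × ℤ))
  | [], v => v
  | c :: u, [] => c :: u
  | c :: u, d :: v => addList c d :: addTable u v

/-- The product of two bivariate coefficient lists. -/
def mulTable (u v : List (List (ℤ × ℤ))) : List (List (ℤ × ℤ)) :=
  u.foldr (fun c r => addTable (v.map (mulList c)) ([] :: r)) []

/-- The product `u(x) v(y)` as a bivariate coefficient list. -/
def outerTable (u v : List (ℤ × ℤ)) : List (List (ℤ × ℤ)) := u.map fun c => smulList c v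

variable {R : Type*} [CommRing R]

/-- The value of a coefficient list at `y`, with `s` in the role of `√-7`. -/
def evalList (s y : R) (u : List (ℤ × ℤ)) : R :=
  u.foldr (fun c r => ((c.1 : R) + c.2 * s) + y * r) 0

/-- The value of a bivariate coefficient list at `(x, y)`, with `s` in the role of `√-7`. -/
def evalTable (s x y : R) (u : List (List (ℤ × ℤ))) : R :=
  u.foldr (fun c r => evalList s y c + x * r) 0

@[simp] lemma evalList_nil (s y : R) : evalList s y [] = 0 := rfl

@[simp] lemma evalList_cons (s y : R) (c : ℤ × ℤ) (u : List (ℤ × ℤ)) :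
    evalList s y (c :: u) = ((c.1 : R) + c.2 * s) + y * evalList s y u := rfl

@[simp] lemma evalTable_nil (s x y : R) : evalTable s x y [] = 0 := rfl

@[simp] lemma evalTable_cons (s x y : R) (c : List (ℤ × ℤ)) (u : List (List (ℤ × ℤ))) :
    evalTable s x y (c :: u) = evalList s y c + x * evalTable s x y u := rfl

lemma evalList_add (s y : R) (u v : List (ℤ × ℤ)) :
    evalList s y (addList u v) = evalList s y u + evalList s y v := by
  induction u generalizing v with
  | nil => simp [addList]
  | cons c u ih =>
    cases v with
    | nil => simp [addList]
    | cons d v => simp only [addList, evalList_cons, ih]; push_cast; ring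

lemma evalTable_add (s x y : R) (u v : List (List (ℤ × ℤ))) :
    evalTable s x y (addTable u v) = evalTable s x y u + evalTable s x y v := by
  induction u generalizing v with
  | nil => simp [addTable]
  | cons c u ih =>
    cases v with
    | nil => simp [addTable]
    | cons d v => simp only [addTable, evalTable_cons, ih, evalList_add]; ring

lemma evalList_conj (s y : R) (u : List (ℤ × ℤ)) :
    evalList s y (conjList u) = evalList (-s) y u := by
  induction u with
  | nil => rfl
  | cons c u ih =>
    simp only [conjList, List.map_cons, evalList_cons] at ih ⊢
    rw [ih]; push_cast; ring

variable {s : R} (hs : s ^ 2 = -7)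
include hs

lemma evalList_smul (y : R) (c : ℤ × ℤ) (u : List (ℤ × ℤ)) :
    evalList s y (smulList c u) = ((c.1 : R) + c.2 * s) * evalList s y u := by
  induction u with
  | nil => simp [smulList]
  | cons d u ih =>
    simp only [smulList, List.map_cons, evalList_cons, mulPair] at ih ⊢
    rw [ih]; push_cast; linear_combination (-(c.2 * d.2 : R)) * hs

lemma evalList_mul (y : R) (u v : List (ℤ × ℤ)) :
    evalList s y (mulList u v) = evalList s y u * evalList s y v := by
  induction u with
  | nil => simp [mulList]
  | cons c u ih =>
    simp only [mulList, List.foldr_cons, evalList_add, evalList_cons, evalList_smul hs] at ih ⊢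
    rw [ih]; push_cast; ring

lemma evalList_pow (y : R) (u : List (ℤ × ℤ)) (n : ℕ) :
    evalList s y (powList u n) = evalList s y u ^ n := by
  induction n with
  | zero => simp [powList]
  | succ n ih => rw [powList, evalList_mul hs, ih, pow_succ]

lemma evalTable_map_mulList (x y : R) (c : List (ℤ × ℤ)) (v : List (List (ℤ × ℤ))) :
    evalTable s x y (v.map (mulList c)) = evalList s y c * evalTable s x y v := by
  induction v with
  | nil => simp
  | cons d v ih => simp only [List.map_cons, evalTable_cons, evalList_mul hs, ih]; ring

lemma evalTable_mul (x y : R) (u v : List (List (ℤ × ℤ))) :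
    evalTable s x y (mulTable u v) = evalTable s x y u * evalTable s x y v := by
  induction u with
  | nil => simp [mulTable]
  | cons c u ih =>
    simp only [mulTable, List.foldr_cons, evalTable_add, evalTable_cons,
      evalTable_map_mulList hs] at ih ⊢
    rw [ih]; simp; ring

lemma evalTable_outer (x y : R) (u v : List (ℤ × ℤ)) :
    evalTable s x y (outerTable u v) = evalList s x u * evalList s y v := by
  induction u with
  | nil => simp [outerTable]
  | cons c u ih =>
    simp only [outerTable, List.map_cons, evalTable_cons, evalList_cons,
      evalList_smul hs] at ih ⊢
    rw [ih]; ring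

omit hs

lemma evalList_eq_zero (s y : R) {u : List (ℤ × ℤ)} (hu : ∀ c ∈ u, c = (0, 0)) :
    evalList s y u = 0 := by
  induction u with
  | nil => rfl
  | cons c u ih =>
    simp only [List.mem_cons, forall_eq_or_imp] at hu
    simp [hu.1, ih hu.2]

lemma evalTable_eq_zero (s x y : R) {u : List (List (ℤ × ℤ))}
    (hu : ∀ c ∈ u, ∀ d ∈ c, d = (0, 0)) : evalTable s x y u = 0 := by
  induction u with
  | nil => rfl
  | cons c u ih =>
    simp only [List.mem_cons, forall_eq_or_imp] at hu
    simp [evalList_eq_zero s y hu.1, ih hu.2]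

/-- The factor of bidegree `(15, 15)`: it vanishes on incident pairs of a point and a hyperplane. -/
def incidenceTable : List (List (ℤ × ℤ)) := [
   [(0, 0), (0, 0), (0, 0), (0, 0), (0, 0), (0, 0), (0, 0), (0, 0), (0, 0), (0, 0), (0, 0),
    (4272472, 1555192), (-16435137, -5467741), (23670579, 7072071), (-15125635, -3961687),
    (3617721, 802165)],
   [(0, 0), (0, 0), (0, 0), (0, 0), (0, 0), (0, 0), (0, 0), (0, 0), (0, 0), (0, 0),
    (-9027712, -5344896), (-33697008, -10207024), (215759836, 78537196), (-354820340, -120920484),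
    (242287764, 73781956), (-60502540, -15846748)],
   [(0, 0), (0, 0), (0, 0), (0, 0), (0, 0), (0, 0), (0, 0), (0, 0), (0, 0), (16121344, 8570368),
    (34804416, 58605504), (218671360, -33250048), (-1496846592, -476015872),
    (2588647296, 912937344), (-1832190400, -609276608), (470792576, 138429312)],
   [(0, 0), (0, 0), (0, 0), (0, 0), (0, 0), (0, 0), (0, 0), (0, 0), (-27770880, -10534912),
    (-5363712, -86603776), (-140860416, -257256448), (-1155770240, 552650368),
    (7046284160, 1627284864), (-12133313152, -4104654976), (8681735296, 2996503168),
    (-2264941056, -717388288)],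
   [(0, 0), (0, 0), (0, 0), (0, 0), (0, 0), (0, 0), (0, 0), (38207488, 9109504),
    (17113088, 113549312), (-289196032, 244406272), (1130831872, 920559616),
    (3734497280, -3104749568), (-23660511616, -3026725760), (40196169088, 12194371456),
    (-28693227136, -9826524288), (7526115968, 2476003456)],
   [(0, 0), (0, 0), (0, 0), (0, 0), (0, 0), (0, 0), (-48758784, -4718592), (43253760, -121372672),
    (-18341888, -235167744), (1856774144, -516972544), (-6773628928, -2768494592),
    (-5171606528, 11141438464), (56400422400, 601312768), (-97505799680, -24691176960),
    (69445450240, 22616592896), (-18227764736, -6021441024)],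
   [(0, 0), (0, 0), (0, 0), (0, 0), (0, 0), (50331648, 0), (-36175872, 108527616),
    (-426967040, 158924800), (1260224512, 446136320), (-9416212480, 734003200),
    (29776576512, 6838321152), (-12700184576, -28657430528), (-89548965888, 13890836480),
    (173454002176, 33112909824), (-125429626880, -37235611648), (33016997888, 10603382784)],
   [(0, 0), (0, 0), (0, 0), (0, 0), (-42991616, 5242880), (37748736, -121634816),
    (309329920, 193986560), (425197568, -1275592704), (-4049797120, 1867055104),
    (28910747648, -4635033600), (-88440406016, -8901328896), (84839849984, 51458859008),
    (74260742144, -43423301632), (-219980103680, -25169887232), (168814673920, 43642093568),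
    (-45084991488, -13640458240)],
   [(0, 0), (0, 0), (0, 0), (33816576, -7602176), (-91095040, 108396544), (172097536, -226099200),
    (-1513619456, 314048512), (2697986048, 2188378112), (2659713024, -7979139072),
    (-52066385920, 18412077056), (173804879872, -3929800704), (-217012273152, -58518831104),
    (27421700096, 70825291776), (183691210752, 1376366592), (-165925744640, -35308711936),
    (46127714304, 12745625600)],
   [(0, 0), (0, 0), (-21241856, 6791168), (62029824, -83394560), (119767040, 263880704),
    (-1459486720, -674889728), (8640266240, 1593835520), (-24965545984, -7200571392),
    (38356385792, 22717923328), (16118185984, -48354557952), (-192210272256, 43786436608),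
    (310842753024, 26046365696), (-157153968128, -66403581952), (-77645299712, 18463834112),
    (113987764224, 18315362304), (-34671083520, -8477458432)],
   [(0, 0), (12253184, -4331520), (-72176640, 53511168), (305283072, -236011520),
    (-1699610624, 785776640), (8378777600, -2046951424), (-33333706752, 3833069568),
    (91518140416, -331874304), (-165794545664, -20101201920), (157468852224, 60437823488),
    (25729171456, -77187514368), (-222891343872, 24806424576), (184529584128, 29675356160),
    (-12410814464, -18547605504), (-50207260672, -4999479296), (18466078720, 3863085056)],
   [(-5159552, 1106048), (39342336, -6728960), (-190017536, -52711424), (756975616, 643733504),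
    (-1580302336, -3357835264), (-2301575168, 11278106624), (31109742592, -26571243520),
    (-115958480896, 41897033728), (248633622528, -36345217024), (-318221844480, -3909091328),
    (199646773248, 44927287296), (11876171776, -35628515328), (-89877118976, 541589504),
    (31134842880, 7611088896), (11492917248, 99090432), (-6553075712, -1127743488)],
   [(19509744, -3756080), (-260557376, 55855424), (1762455552, -320811008),
    (-7893993472, 915843072), (24907409408, -713967616), (-55032520704, -4705017856),
    (77634699264, 21851963392), (-43443552256, -49028268032), (-73043869696, 66041217024),
    (195820257280, -49595285504), (-198237487104, 11448352768), (86713040896, 8950644736),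
    (1472200704, -4416602112), (-11538530304, -952107008), (-263192576, 286261248),
    (1380974592, 185597952)],
   [(-27571920, 4631952), (423086272, -83877312), (-3106867200, 641722368),
    (14447826944, -2838886400), (-46942595072, 8044906496), (110662328320, -14778408960),
    (-189763911680, 15816818688), (229623463936, -3760193536), (-178854100992, -15887695872),
    (63101992960, 25166086144), (24194842624, -16804478976), (-35156656128, 4454350848),
    (11802771456, 159383552), (25165824, -75497472), (-297795584, -46137344),
    (-130023424, -12582912)],
   [(17252816, -2419856), (-283135680, 48761792), (2174772224, -418468864),
    (-10376886272, 2088949760), (34245220352, -6829455360), (-82117419008, 15399313408),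
    (145945821184, -24312971264), (-192179339264, 26451902464), (183911907328, -18649776128),
    (-122445103104, 7056654336), (51919192064, -136314880), (-11198791680, -981467136),
    (67108864, 301989888), (318767104, -16777216), (0, 0), (0, 0)],
   [(-4031088, 437936), (69011264, -9679424), (-546924544, 89966592), (2664947712, -482631680),
    (-8915802112, 1693054976), (21609717760, -4124418048), (-38943686656, 7176683520),
    (52627636224, -8987475968), (-53050540032, 8022851584), (39150944256, -4962123776),
    (-20424163328, 2011168768), (7088373760, -478150656), (-1459617792, 50331648), (134217728, 0),
    (0, 0), (0, 0)]]

/-- The factor of bidegree `(16, 16)`: it vanishes on non-incident pairs. -/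
def nonincidenceTable : List (List (ℤ × ℤ)) := [
   [(0, 0), (0, 0), (0, 0), (0, 0), (0, 0), (0, 0), (0, 0), (0, 0), (0, 0), (0, 0),
    (-6438912, -25247744), (56700928, 134901760), (-180470016, -297819392),
    (283649024, 347214848), (-238552576, -225029632), (103166976, 76669952),
    (-18055424, -10689792)],
   [(0, 0), (0, 0), (0, 0), (0, 0), (0, 0), (0, 0), (0, 0), (0, 0), (0, 0), (26476544, -71041024),
    (-83034112, 1073283072), (-561721344, -4563169280), (2960363520, 9247346688),
    (-5490237440, -10336919552), (5015248896, 6550986752), (-2279763968, -2207166464),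
    (412667904, 306679808)],
   [(0, 0), (0, 0), (0, 0), (0, 0), (0, 0), (0, 0), (0, 0), (0, 0), (168820736, -70254592),
    (-2240544768, 2099511296), (10154295296, -18783322112), (-17047846912, 68450287616),
    (1496580096, -129505165312), (30371348480, 139635589120), (-39605026816, -86751428608),
    (20756398080, 28930703360), (-4054024192, -4005920768)],
   [(0, 0), (0, 0), (0, 0), (0, 0), (0, 0), (0, 0), (0, 0), (268435456, 0),
    (-6295650304, 1304428544), (52511637504, -25632440320), (-208964747264, 181893267456),
    (423037599744, -599560323072), (-425828352000, 1077825699840), (144328491008, -1129479012352),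
    (89949995008, 690444304384), (-90603749376, -228320706560), (21596340224, 31524782080)],
   [(0, 0), (0, 0), (0, 0), (0, 0), (0, 0), (0, 0), (150994944, 50331648),
    (-6576668672, -704643072), (92011495424, -6726615040), (-605373857792, 164220108800),
    (2154423910400, -1085175758848), (-4342185852928, 3397488345088),
    (5007165784064, -5918673829888), (-3125442445312, 6085495291904),
    (805326946304, -3678864801792), (80601219072, 1209662504960), (-60101525504, -166770933760)],
   [(0, 0), (0, 0), (0, 0), (0, 0), (0, 0), (0, 0), (-2164260864, -855638016),
    (64038633472, 11928600576), (-718150828032, -16217276416), (4122415726592, -567462068224),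
    (-13540636229632, 4161897758720), (26532740071424, -13055696306176),
    (-31422213521408, 22551222812672), (21985915568128, -23016160362496),
    (-8312828985344, 13849502154752), (1270473818112, -4545147830272), (20410007552, 626988154880)],
   [(0, 0), (0, 0), (0, 0), (0, 0), (68419584, -71565312), (-810024960, 1143472128),
    (17480024064, -1691615232), (-353294614528, -55431921664), (3449665093632, 254681284608),
    (-18176800718848, 924068085760), (56474994737152, -10414020624384),
    (-107687337525248, 34844205645824), (127729316397056, -61237385232384),
    (-92836297965568, 62871303094272), (38975683166208, -37944345755648),
    (-8119794008064, 12485575835648), (527127019520, -1728030703616)],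
   [(0, 0), (0, 0), (0, 0), (235405312, -48758784), (-4871487488, 1812529152),
    (40991850496, -22092840960), (-239341993984, 112783851520), (1707898306560, -165280481280),
    (-11943440023552, -417542963200), (56134702465024, -659764019200),
    (-165239165288448, 17697811202048), (306781848862720, -66030145634304),
    (-361470009278464, 120643123150848), (266451873169408, -126148889542656),
    (-116844350406656, 76942560722944), (26970291175424, -25506802040832),
    (-2346662756352, 3552474824704)],
   [(0, 0), (0, 0), (237375488, 30945280), (-7179550720, -376832), (89242554368, -10814099456),
    (-609164599296, 144667156480), (2701371310080, -849942872064),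
    (-9942937698304, 2535579516928), (38258701762560, -3702455009280),
    (-136590777647104, 4918855860224), (360721816748032, -25987383296000),
    (-640130385707008, 93936508993536), (741598781505536, -176324141383680),
    (-547428763697152, 188373692055552), (244869383585792, -116636914810880),
    (-59268107599872, 39095938056192), (5737781657600, -5493620736000)],
   [(0, 0), (113546240, 57490432), (-4634348544, -1434199040), (78641491968, 12940201984),
    (-739687798784, -34052851712), (4336684507136, -251160535040),
    (-17115140325376, 2491281047552), (50066382389248, -9617760321536),
    (-126037957672960, 20496828203008), (302985019654144, -29321130934272),
    (-640933112578048, 49729891205120), (1027879508901888, -114717720838144),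
    (-1140422181126144, 199607011246080), (829734330040320, -212792208523264),
    (-372721791795200, 133103888629760), (92306497601536, -45107222937600),
    (-9412672487424, 6400793116672)],
   [(26455488, 23310656), (-1437479680, -926136576), (32787541568, 14627660480),
    (-414526735616, -121555382016), (3269112802304, 560317367296),
    (-17166291226624, -1190259617792), (62767187623936, -1125545410560),
    (-167409492787200, 14493994418176), (349378676260864, -42732019253248),
    (-625299075629056, 72808707653632), (1001415162724352, -96911144779776),
    (-1345449937076224, 136568103763968), (1361739081842688, -187125169389568),
    (-949629197746176, 186308886528000), (420502531211264, -115081501212672),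
    (-104686606614528, 39126078324736), (10951998832640, -5592617844736)],
   [(-121801424, -128601712), (5309395152, 4103716976), (-101983633792, -56931112064),
    (1133315727744, 448945484928), (-8127746798080, -2190720669184),
    (39868083178496, 6629810185216), (-138740610203648, -10996339736576),
    (352989599506432, 2181295792128), (-680803145580544, 33895768227840),
    (1047263937036288, -86102612639744), (-1353540736909312, 124624542105600),
    (1483276145393664, -143542852780032), (-1302426149715968, 150723153100800),
    (836721671405568, -129661472342016), (-355585040056320, 75782416236544),
    (87251723747328, -25360171270144), (-9184250691584, 3621194301440)],
   [(220408959, 293954333), (-9161756784, -8647211856), (165976224768, 113298119680),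
    (-1743870040320, -867854887680), (11916550977152, 4280894788480),
    (-56229335785472, -14068814815232), (189875001657344, 30501483485184),
    (-470388100268032, -40140725452800), (874540759642112, 19923540627456),
    (-1253893991497728, 32101005459456), (1432108072304640, -83247135850496),
    (-1333808816193536, 104396359729152), (1001598520131584, -96928889044992),
    (-572258363899904, 71403671912448), (225854093262848, -37872971284480),
    (-53252225761280, 12115029000192), (5524670119936, -1700538613760)],
   [(-192731356, -356013332), (8328550816, 10062244064), (-150910220800, -127970536960),
    (1562684237312, 964284232192), (-10478478697216, -4768986794240),
    (48545305636864, 16190558310400), (-161352961134592, -38272342536192),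
    (394062144815104, 62228178124800), (-719583571148800, -65759595134976),
    (998200081907712, 35895329947648), (-1069669130698752, 9107080740864),
    (898628220616704, -38275613982720), (-592632413683712, 41327693660160),
    (298041772867584, -28842752212992), (-106211185786880, 13908580499456),
    (23358179639296, -4142495956992), (-2327872274432, 558345748480)],
   [(76922234, 240671278), (-3931339104, -6655881248), (75571333952, 83270818240),
    (-799007215616, -621825863680), (5383853095424, 3079911894528),
    (-24899386947584, -10635416741888), (82425489899520, 26195845136384),
    (-200298281959424, -46251338235904), (363040985882624, 57806879055872),
    (-496099054714880, -49024451870720), (515085339459584, 24540739534848),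
    (-408187570225152, -1868937822208), (246218344103936, -7811458138112),
    (-110826774069248, 7095093035008), (35270153994240, -3413240709120),
    (-7038646091776, 951603691520), (652835028992, -120259084288)],
   [(-7012044, -85975268), (807131536, 2349679280), (-18582549120, -29141075840),
    (210850969728, 216683878784), (-1467383483136, -1075457769728),
    (6893230433280, 3755111934976), (-22995893317632, -9474380288000),
    (56083181379584, 17469369212928), (-101685226536960, -23519808946176),
    (138301600694272, 22790310199296), (-141553444061184, -15296396001280),
    (108760733319168, 6391223812096), (-62103775870976, -951544971264),
    (25751147511808, -610019573760), (-7382511910912, 443992244224),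
    (1314796863488, -127238406144), (-109521666048, 15032385536)],
   [(-2241857, 12654045), (-28048176, -343901072), (1538276480, 4249380224),
    (-21144289792, -31568528896), (159340415872, 157167170176), (-779307022336, -553546508288),
    (2659429726208, 1419654244352), (-6574829469696, -2689104609280),
    (12016818483200, 3775433625600), (-16392980987904, -3903471812608),
    (16715315806208, 2915135782912), (-12658449317888, -1507384623104),
    (7007085002752, 487788118016), (-2751362760704, -66806874112), (725413265408, -13119782912),
    (-115158810624, 6710886400), (8321499136, -805306368)]]

/-- The coefficients of `512 x²¹ (x - 1)⁷ (x - a₁)³`. -/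
def numList : List (ℤ × ℤ) :=
  mulList (mulList (powList [(0, 0), (1, 0)] 21) (powList [(-1, 0), (1, 0)] 7))
    (powList [(-11, 1), (8, 0)] 3)

/-- The coefficients of `2⁶³ (x² - 2x + a₂)⁸ (x³ - 2x² + a₃x + a₄)⁴ (x - a₅)`. -/
def denList : List (ℤ × ℤ) :=
  mulList (mulList (powList [(11, -1), (-32, 0), (16, 0)] 8)
    (powList [(-31, -3), (168, 8), (-256, 0), (128, 0)] 4)) [(-3, 1), (8, 0)]

/-- The table whose vanishing is the factorization into `incidenceTable` and
`nonincidenceTable`. -/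
def defectTable : List (List (ℤ × ℤ)) :=
  addTable (addTable (outerTable (smulList (31, -3) numList) (conjList denList))
      (outerTable (smulList (-32, 0) denList) (conjList numList)))
    (mulTable (mulTable [[(-2 ^ 17, 0)]] incidenceTable) nonincidenceTable)

/-! The vanishing of `defectTable` is checked by Kronecker substitution: its value at
`(N ^ (W + 1), N)` is zero, and `N` exceeds all its entries. -/

/-- The sum of the absolute values of the two coordinates. -/
def pairNorm (c : ℤ × ℤ) : ℕ := c.1.natAbs + c.2.natAbs

/-- The sum of the norms of the coefficients. -/
def listNorm (u : List (ℤ × ℤ)) : ℕ := (u.map pairNorm).sum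

/-- The sum of the norms of the coefficients. -/
def tableNorm (u : List (List (ℤ × ℤ))) : ℕ := (u.map listNorm).sum

lemma pairNorm_mul_le (c d : ℤ × ℤ) : pairNorm (mulPair c d) ≤ 7 * pairNorm c * pairNorm d := by
  have h1 := Int.natAbs_sub_le (c.1 * d.1) (7 * (c.2 * d.2))
  have h2 := Int.natAbs_add_le (c.1 * d.2) (c.2 * d.1)
  simp only [Int.natAbs_mul] at h1 h2
  simp only [pairNorm, mulPair]
  norm_num at h1
  nlinarith [Nat.zero_le (c.1.natAbs * d.1.natAbs), Nat.zero_le (c.1.natAbs * d.2.natAbs),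
    Nat.zero_le (c.2.natAbs * d.1.natAbs), Nat.zero_le (c.2.natAbs * d.2.natAbs)]

@[simp] lemma listNorm_nil : listNorm [] = 0 := rfl

@[simp] lemma listNorm_cons (c : ℤ × ℤ) (u : List (ℤ × ℤ)) :
    listNorm (c :: u) = pairNorm c + listNorm u := by simp [listNorm]

@[simp] lemma tableNorm_nil : tableNorm [] = 0 := rfl

@[simp] lemma tableNorm_cons (c : List (ℤ × ℤ)) (u : List (List (ℤ × ℤ))) :
    tableNorm (c :: u) = listNorm c + tableNorm u := by simp [tableNorm]

lemma listNorm_add_le (u v : List (ℤ × ℤ)) :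
    listNorm (addList u v) ≤ listNorm u + listNorm v := by
  induction u generalizing v with
  | nil => simp [addList]
  | cons c u ih =>
    cases v with
    | nil => simp [addList]
    | cons d v =>
      have h1 := Int.natAbs_add_le c.1 d.1
      have h2 := Int.natAbs_add_le c.2 d.2
      have h3 := ih v
      simp only [addList, listNorm_cons, pairNorm]
      omega

lemma tableNorm_add_le (u v : List (List (ℤ × ℤ))) :
    tableNorm (addTable u v) ≤ tableNorm u + tableNorm v := by
  induction u generalizing v with
  | nil => simp [addTable]
  | cons c u ih =>
    cases v with
    | nil => simp [addTable]
    | cons d v =>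
      have h1 := listNorm_add_le c d
      have h2 := ih v
      simp only [addTable, tableNorm_cons]
      omega

lemma listNorm_smul_le (c : ℤ × ℤ) (u : List (ℤ × ℤ)) :
    listNorm (smulList c u) ≤ 7 * pairNorm c * listNorm u := by
  induction u with
  | nil => simp [smulList]
  | cons d u ih =>
    have h := pairNorm_mul_le c d
    simp only [smulList, List.map_cons, listNorm_cons] at ih ⊢
    linarith

lemma listNorm_mul_le (u v : List (ℤ × ℤ)) :
    listNorm (mulList u v) ≤ 7 * listNorm u * listNorm v := by
  induction u with
  | nil => simp [mulList]
  | cons c u ih =>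
    have h1 := listNorm_add_le (smulList c v) ((0, 0) :: mulList u v)
    have h2 := listNorm_smul_le c v
    have h3 : pairNorm (0, 0) = 0 := rfl
    have h4 : mulList (c :: u) v = addList (smulList c v) ((0, 0) :: mulList u v) := rfl
    rw [h4]
    simp only [listNorm_cons, h3] at h1 ⊢
    linarith

lemma tableNorm_mul_le (u v : List (List (ℤ × ℤ))) :
    tableNorm (mulTable u v) ≤ 7 * tableNorm u * tableNorm v := by
  induction u with
  | nil => simp [mulTable]
  | cons c u ih =>
    have h1 := tableNorm_add_le (v.map (mulList c)) ([] :: mulTable u v)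
    have h2 : tableNorm (v.map (mulList c)) ≤ 7 * listNorm c * tableNorm v := by
      clear h1 ih
      induction v with
      | nil => simp
      | cons d v ih =>
        have h := listNorm_mul_le c d
        simp only [List.map_cons, tableNorm_cons]
        linarith
    have h4 : mulTable (c :: u) v = addTable (v.map (mulList c)) ([] :: mulTable u v) := rfl
    rw [h4]
    simp only [tableNorm_cons, listNorm_nil] at h1 ⊢
    linarith

lemma tableNorm_outer_le (u v : List (ℤ × ℤ)) :
    tableNorm (outerTable u v) ≤ 7 * listNorm u * listNorm v := by
  induction u with
  | nil => simp [outerTable]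
  | cons c u ih =>
    have h := listNorm_smul_le c v
    simp only [outerTable, List.map_cons, tableNorm_cons, listNorm_cons] at ih ⊢
    linarith

lemma length_addList (u v : List (ℤ × ℤ)) :
    (addList u v).length = max u.length v.length := by
  induction u generalizing v with
  | nil => simp [addList]
  | cons c u ih =>
    cases v with
    | nil => simp [addList]
    | cons d v => simp [addList, ih]

lemma length_mulList_le (u v : List (ℤ × ℤ)) :
    (mulList u v).length ≤ u.length + v.length := by
  induction u with
  | nil => simp [mulList]
  | cons c u ih =>
    have h4 : mulList (c :: u) v = addList (smulList c v) ((0, 0) :: mulList u v) := rfl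
    rw [h4, length_addList]
    simp only [smulList, List.length_map, List.length_cons]
    omega

lemma length_addTable_le {m : ℕ} {u v : List (List (ℤ × ℤ))} (hu : ∀ c ∈ u, c.length ≤ m)
    (hv : ∀ c ∈ v, c.length ≤ m) : ∀ c ∈ addTable u v, c.length ≤ m := by
  induction u generalizing v with
  | nil => simpa [addTable] using hv
  | cons c u ih =>
    cases v with
    | nil => simpa [addTable] using hu
    | cons d v =>
      simp only [List.mem_cons, forall_eq_or_imp] at hu hv
      simp only [addTable, List.mem_cons, forall_eq_or_imp, length_addList]
      exact ⟨max_le hu.1 hv.1, ih hu.2 hv.2⟩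

lemma length_mulTable_le {m n : ℕ} {u v : List (List (ℤ × ℤ))} (hu : ∀ c ∈ u, c.length ≤ m)
    (hv : ∀ c ∈ v, c.length ≤ n) : ∀ c ∈ mulTable u v, c.length ≤ m + n := by
  induction u with
  | nil => simp [mulTable]
  | cons c u ih =>
    simp only [List.mem_cons, forall_eq_or_imp] at hu
    have h4 : mulTable (c :: u) v = addTable (v.map (mulList c)) ([] :: mulTable u v) := rfl
    rw [h4]
    refine length_addTable_le ?_ ?_
    · simp only [List.mem_map, forall_exists_index, and_imp, forall_apply_eq_imp_iff₂]
      intro d hd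
      exact (length_mulList_le c d).trans (add_le_add hu.1 (hv d hd))
    · simpa using ih hu.2

lemma length_outerTable (u v : List (ℤ × ℤ)) : ∀ c ∈ outerTable u v, c.length = v.length := by
  intro c hc
  simp only [outerTable, List.mem_map] at hc
  obtain ⟨d, _, rfl⟩ := hc
  simp [smulList]

lemma natAbs_evalList_le (N : ℕ) (hN : 1 ≤ N) (u : List (ℤ × ℤ)) :
    (evalList (Zsqrtd.sqrtd : ℤ√(-7)) (N : ℤ√(-7)) u).re.natAbs ≤ listNorm u * N ^ u.length ∧
    (evalList (Zsqrtd.sqrtd : ℤ√(-7)) (N : ℤ√(-7)) u).im.natAbs ≤ listNorm u * N ^ u.length := by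
  induction u with
  | nil => simp
  | cons c u ih =>
    obtain ⟨h1, h2⟩ := ih
    have hpow : 1 ≤ N ^ u.length := Nat.one_le_pow _ _ hN
    have aux : ∀ a b : ℤ, ∀ k : ℕ, a.natAbs ≤ k → b.natAbs ≤ listNorm u * N ^ u.length →
        (a + N * b).natAbs ≤ (k + listNorm u) * N ^ (u.length + 1) := by
      intro a b k ha hb
      have h := Int.natAbs_add_le a (N * b)
      rw [Int.natAbs_mul, Int.natAbs_natCast] at h
      have h3 : k ≤ k * N ^ (u.length + 1) := Nat.le_mul_of_pos_right _ (by positivity)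
      have h4 := Nat.mul_le_mul_left N hb
      calc _ ≤ k * N ^ (u.length + 1) + N * (listNorm u * N ^ u.length) := by omega
        _ = _ := by ring
    constructor
    · have := aux c.1 _ (pairNorm c) (Nat.le_add_right _ _) h1
      simpa using this
    · have := aux c.2 _ (pairNorm c) (Nat.le_add_left _ _) h2
      simpa using this

lemma int_eq_zero_of_add_mul_eq_zero {a b : ℤ} {N : ℕ} (ha : a.natAbs < N)
    (h : a + N * b = 0) : a = 0 ∧ b = 0 := by
  have ha0 : a = 0 :=
    Int.eq_zero_of_abs_lt_dvd (m := N) ⟨-b, by linear_combination h⟩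
      (by rw [Int.abs_eq_natAbs]; omega)
  subst ha0
  have hN : N ≠ 0 := by simp at ha; omega
  simpa [hN] using h

lemma eq_zero_of_evalList_eq_zero {N : ℕ} {u : List (ℤ × ℤ)} (hu : listNorm u < N)
    (h : evalList (Zsqrtd.sqrtd : ℤ√(-7)) (N : ℤ√(-7)) u = 0) : ∀ c ∈ u, c = (0, 0) := by
  induction u with
  | nil => simp
  | cons c u ih =>
    rw [listNorm_cons, pairNorm] at hu
    have hre := congrArg Zsqrtd.re h
    have him := congrArg Zsqrtd.im h
    simp at hre him
    obtain ⟨h1, h2⟩ := int_eq_zero_of_add_mul_eq_zero (by omega) hre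
    obtain ⟨h3, h4⟩ := int_eq_zero_of_add_mul_eq_zero (by omega) him
    simp only [List.mem_cons, forall_eq_or_imp]
    exact ⟨Prod.ext h1 h3, ih (by omega) (Zsqrtd.ext h2 h4)⟩

lemma eq_zero_of_evalTable_eq_zero {N W : ℕ} {u : List (List (ℤ × ℤ))} (hu : tableNorm u < N)
    (hW : ∀ c ∈ u, c.length ≤ W)
    (h : evalTable (Zsqrtd.sqrtd : ℤ√(-7)) ((N ^ (W + 1) : ℕ) : ℤ√(-7)) (N : ℤ√(-7)) u = 0) :
    ∀ c ∈ u, ∀ d ∈ c, d = (0, 0) := by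
  induction u with
  | nil => simp
  | cons c u ih =>
    simp only [List.mem_cons, forall_eq_or_imp] at hW ⊢
    rw [tableNorm_cons] at hu
    have hN : 1 ≤ N := by omega
    have hb : listNorm c * N ^ c.length < N ^ (W + 1) :=
      calc listNorm c * N ^ c.length ≤ listNorm c * N ^ W := by gcongr; exact hW.1
        _ < N * N ^ W := by gcongr; omega
        _ = N ^ (W + 1) := by ring
    obtain ⟨hb1, hb2⟩ := natAbs_evalList_le N hN c
    rw [evalTable_cons] at h
    have hre := congrArg Zsqrtd.re h
    have him := congrArg Zsqrtd.im h
    rw [Zsqrtd.re_add, Zsqrtd.re_mul, Zsqrtd.re_natCast, Zsqrtd.im_natCast, mul_zero, zero_mul,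
      add_zero] at hre
    rw [Zsqrtd.im_add, Zsqrtd.im_mul, Zsqrtd.re_natCast, Zsqrtd.im_natCast, zero_mul,
      add_zero] at him
    obtain ⟨h1, h2⟩ := int_eq_zero_of_add_mul_eq_zero (hb1.trans_lt hb) hre
    obtain ⟨h3, h4⟩ := int_eq_zero_of_add_mul_eq_zero (hb2.trans_lt hb) him
    exact ⟨eq_zero_of_evalList_eq_zero (by omega) (Zsqrtd.ext h1 h3),
      ih (by omega) hW.2 (Zsqrtd.ext h2 h4)⟩

lemma sqrtd_sq : (Zsqrtd.sqrtd : ℤ√(-7)) ^ 2 = -7 := by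
  rw [pow_two, Zsqrtd.dmuld]; rfl

lemma length_defectTable_le : ∀ c ∈ defectTable, c.length ≤ 40 := by
  have h1 : (conjList denList).length ≤ 40 := by decide +kernel
  have h2 : (conjList numList).length ≤ 40 := by decide +kernel
  have h3 : ∀ c ∈ incidenceTable, c.length ≤ 16 := by decide +kernel
  have h4 : ∀ c ∈ nonincidenceTable, c.length ≤ 17 := by decide +kernel
  refine length_addTable_le (length_addTable_le ?_ ?_) ?_
  · exact fun c hc => (length_outerTable _ _ c hc).trans_le h1
  · exact fun c hc => (length_outerTable _ _ c hc).trans_le h2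
  · exact fun c hc => (length_mulTable_le (length_mulTable_le (m := 1) (by simp) h3) h4 c hc).trans
      (by norm_num)

lemma tableNorm_defectTable_lt : tableNorm defectTable < 2 ^ 160 := by
  have hf : listNorm (smulList (31, -3) numList) < 2 ^ 40 := by decide +kernel
  have hg : listNorm (conjList denList) < 2 ^ 100 := by decide +kernel
  have hf' : listNorm (conjList numList) < 2 ^ 40 := by decide +kernel
  have hg' : listNorm (smulList (-32, 0) denList) < 2 ^ 100 := by decide +kernel
  have hA : tableNorm incidenceTable < 2 ^ 50 := by decide +kernel
  have hB : tableNorm nonincidenceTable < 2 ^ 65 := by decide +kernel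
  have hc : tableNorm [[(-2 ^ 17, 0)]] = 2 ^ 17 := by decide +kernel
  have h1 := tableNorm_add_le
    (addTable (outerTable (smulList (31, -3) numList) (conjList denList))
      (outerTable (smulList (-32, 0) denList) (conjList numList)))
    (mulTable (mulTable [[(-2 ^ 17, 0)]] incidenceTable) nonincidenceTable)
  have h2 := tableNorm_add_le (outerTable (smulList (31, -3) numList) (conjList denList))
      (outerTable (smulList (-32, 0) denList) (conjList numList))
  have h3 := tableNorm_outer_le (smulList (31, -3) numList) (conjList denList)
  have h4 := tableNorm_outer_le (smulList (-32, 0) denList) (conjList numList)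
  have h5 := tableNorm_mul_le (mulTable [[(-2 ^ 17, 0)]] incidenceTable) nonincidenceTable
  have h6 := tableNorm_mul_le [[(-2 ^ 17, 0)]] incidenceTable
  rw [hc] at h6
  have h7 : listNorm (smulList (31, -3) numList) * listNorm (conjList denList) ≤ 2 ^ 40 * 2 ^ 100 :=
    Nat.mul_le_mul hf.le hg.le
  have h8 : listNorm (smulList (-32, 0) denList) * listNorm (conjList numList) ≤ 2 ^ 100 * 2 ^ 40 :=
    Nat.mul_le_mul hg'.le hf'.le
  have h9 : tableNorm (mulTable [[(-2 ^ 17, 0)]] incidenceTable) * tableNorm nonincidenceTable ≤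
      (7 * 2 ^ 17 * 2 ^ 50) * 2 ^ 65 :=
    Nat.mul_le_mul (h6.trans (Nat.mul_le_mul_left _ hA.le)) hB.le
  rw [defectTable]
  linarith

lemma defectTable_eq_zero : ∀ c ∈ defectTable, ∀ d ∈ c, d = (0, 0) := by
  refine eq_zero_of_evalTable_eq_zero tableNorm_defectTable_lt length_defectTable_le ?_
  rw [defectTable, evalTable_add, evalTable_add, evalTable_outer sqrtd_sq,
    evalTable_outer sqrtd_sq, evalTable_mul sqrtd_sq, evalTable_mul sqrtd_sq]
  decide +kernel

include hs in
lemma evalList_numList (x : R) :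
    evalList s x numList = x ^ 21 * (x - 1) ^ 7 * (8 * x - 11 + s) ^ 3 := by
  rw [numList, evalList_mul hs, evalList_mul hs, evalList_pow hs, evalList_pow hs,
    evalList_pow hs]
  simp only [evalList_cons, evalList_nil]
  push_cast
  congr 1
  · congr 1 <;> congr 1 <;> ring
  · congr 1; ring

include hs in
lemma evalList_denList (x : R) :
    evalList s x denList = (16 * x ^ 2 - 32 * x + 11 - s) ^ 8 *
      (128 * x ^ 3 - 256 * x ^ 2 + (168 + 8 * s) * x - 31 - 3 * s) ^ 4 * (8 * x - 3 + s) := by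
  rw [denList, evalList_mul hs, evalList_mul hs, evalList_pow hs, evalList_pow hs]
  simp only [evalList_cons, evalList_nil]
  push_cast
  congr 1
  · congr 1 <;> congr 1 <;> ring
  · ring

/-- The factorization of the fibre product of the two covers into the incidence and the
non-incidence curve. -/
lemma incidence_mul_nonincidence {s : R} (hs : s ^ 2 = -7) (x y : R) :
    2 ^ 17 * (evalTable s x y incidenceTable * evalTable s x y nonincidenceTable) =
      (31 - 3 * s) * (evalList s x numList * evalList (-s) y denList) -
      32 * (evalList s x denList * evalList (-s) y numList) := by
  have h := evalTable_eq_zero s x y defectTable_eq_zero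
  rw [defectTable, evalTable_add, evalTable_add, evalTable_outer hs, evalTable_outer hs,
    evalTable_mul hs, evalTable_mul hs, evalList_smul hs, evalList_smul hs, evalList_conj,
    evalList_conj] at h
  generalize evalList s x numList = a, evalList s x denList = b, evalList (-s) y numList = c,
    evalList (-s) y denList = d, evalTable s x y incidenceTable = e,
    evalTable s x y nonincidenceTable = f at h ⊢
  simp only [evalList_cons, evalList_nil, evalTable_cons, evalTable_nil] at h
  push_cast at h
  linear_combination -h

end Certificate

section Transvections

/-! ### Subgroups of `GL_n(𝔽₂)` containing a transvection -/

open Matrix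

variable {n : ℕ} {H : Subgroup (GL (Fin n) (ZMod 2))}

lemma zmod_two_eq_zero_or_one (a : ZMod 2) : a = 0 ∨ a = 1 := by revert a; decide

lemma add_self_vec (v : Fin n → ZMod 2) : v + v = 0 := by
  ext i; exact CharTwo.add_self_eq_zero _

/-- `H` contains the transvection with centre `P` and axis `ker h`, or the identity if one of these
two vectors is zero. -/
def HasTransvection (H : Subgroup (GL (Fin n) (ZMod 2))) (P h : Fin n → ZMod 2) :
    Prop :=
  h ⬝ᵥ P = 0 ∧ ∃ M ∈ H, M.1 = 1 + vecMulVec P h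

namespace HasTransvection

variable {P Q h k : Fin n → ZMod 2}

lemma zero_right (P : Fin n → ZMod 2) : HasTransvection H P 0 := ⟨by simp, 1, H.one_mem, by simp⟩

lemma zero_left (h : Fin n → ZMod 2) : HasTransvection H 0 h := ⟨by simp, 1, H.one_mem, by simp⟩

lemma add_right (hh : HasTransvection H P h) (hk : HasTransvection H P k) :
    HasTransvection H P (h + k) := by
  obtain ⟨h0, M, hM, hM'⟩ := hh
  obtain ⟨k0, N, hN, hN'⟩ := hk
  refine ⟨by rw [add_dotProduct, h0, k0, add_zero], M * N, H.mul_mem hM hN, ?_⟩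
  rw [Units.val_mul, hM', hN', mul_add, add_mul, add_mul,
    vecMulVec_mul_vecMulVec, h0, zero_smul, vecMulVec_add]
  simp [add_assoc]

lemma add_left (hP : HasTransvection H P h) (hQ : HasTransvection H Q h) :
    HasTransvection H (P + Q) h := by
  obtain ⟨h0, M, hM, hM'⟩ := hP
  obtain ⟨k0, N, hN, hN'⟩ := hQ
  refine ⟨by rw [dotProduct_add, h0, k0, add_zero], M * N, H.mul_mem hM hN, ?_⟩
  rw [Units.val_mul, hM', hN', mul_add, add_mul, add_mul,
    vecMulVec_mul_vecMulVec, k0, zero_smul, add_vecMulVec]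
  simp [add_assoc]

lemma conj (hP : HasTransvection H P h) {N : GL (Fin n) (ZMod 2)} (hN : N ∈ H) :
    HasTransvection H (N.1 *ᵥ P) (h ᵥ* N⁻¹.1) := by
  obtain ⟨h0, M, hM, hM'⟩ := hP
  have hNN : N⁻¹.1 * N.1 = 1 := by
    rw [← Units.val_mul, inv_mul_cancel, Units.val_one]
  have hNN' : N.1 * N⁻¹.1 = 1 := by
    rw [← Units.val_mul, mul_inv_cancel, Units.val_one]
  refine ⟨?_, N * M * N⁻¹, H.mul_mem (H.mul_mem hN hM) (H.inv_mem hN), ?_⟩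
  · rw [dotProduct_mulVec, vecMul_vecMul, hNN, vecMul_one, h0]
  · rw [Units.val_mul, Units.val_mul, hM', mul_add, add_mul, mul_one,
      hNN', mul_vecMulVec, vecMulVec_mul]

lemma of_dotProduct (hP : HasTransvection H P h) (hQ : HasTransvection H Q k) (hhQ : h ⬝ᵥ Q = 1)
    (hkP : k ⬝ᵥ P = 0) : HasTransvection H P k := by
  obtain ⟨M, hM, hM'⟩ := hP.2
  have hMM : M * M = 1 := by
    apply Units.ext
    rw [Units.val_mul, hM', Units.val_one, mul_add, add_mul, add_mul,
      vecMulVec_mul_vecMulVec, hP.1, zero_smul]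
    simp only [one_mul, mul_one, vecMulVec_zero, add_zero, add_assoc]
    rw [← vecMulVec_add, add_self_vec, vecMulVec_zero, add_zero]
  have hinv : M⁻¹ = M := inv_eq_of_mul_eq_one_left hMM
  have h1 := hQ.conj hM
  rw [hinv, hM', add_mulVec, vecMul_add, vecMulVec_mulVec, vecMul_vecMulVec, hhQ, hkP] at h1
  have h2 := hQ.add_left (by simpa using h1)
  rwa [← add_assoc, add_self_vec, zero_add] at h2

end HasTransvection

lemma eq_zero_or_eq_of_forall_dotProduct {h k : Fin n → ZMod 2} (hk : k ≠ 0)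
    (H : ∀ P, k ⬝ᵥ P = 0 → h ⬝ᵥ P = 0) : h = 0 ∨ h = k := by
  obtain ⟨i, hi⟩ := Function.ne_iff.mp hk
  have hi : k i = 1 := (zmod_two_eq_zero_or_one _).resolve_left hi
  have key : ∀ j, h j = k j * h i := by
    intro j
    have h1 := H (Pi.single j 1 + Pi.single i (k j)) (by
      simp [dotProduct_add, hi, CharTwo.add_self_eq_zero])
    simp only [dotProduct_add, dotProduct_single, mul_one] at h1
    rw [CharTwo.add_eq_zero.mp h1, mul_comm]
  rcases zmod_two_eq_zero_or_one (h i) with h0 | h0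
  · left; ext j; rw [key, h0]; simp
  · right; ext j; rw [key, h0]; simp

lemma exists_mulVec_eq_zero_of_alternating (hn : Odd n) (N : Matrix (Fin n) (Fin n) (ZMod 2))
    (hsymm : ∀ i j, N i j = N j i) (hdiag : ∀ i, N i i = 0) : ∃ v ≠ 0, N *ᵥ v = 0 := by
  rw [exists_mulVec_eq_zero_iff]
  let L : Matrix (Fin n) (Fin n) ℤ := fun i j =>
    if i < j then ((N i j).val : ℤ) else if j < i then -((N j i).val : ℤ) else 0
  have hL : Lᵀ = -L := by
    ext i j
    have h1 : Lᵀ i j = L j i := rfl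
    have h2 : (-L) i j = -L i j := rfl
    rw [h1, h2]
    simp only [L]
    rcases lt_trichotomy i j with h | h | h
    · simp [h, h.not_gt]
    · simp [h]
    · simp [h, h.not_gt]
  have hdet : L.det = 0 := by
    have h := congrArg det hL
    rw [det_transpose, det_neg, Fintype.card_fin, hn.neg_one_pow] at h
    omega
  have hLN : L.map (Int.castRingHom (ZMod 2)) = N := by
    ext i j
    have h1 : L.map (Int.castRingHom (ZMod 2)) i j = ((L i j : ℤ) : ZMod 2) := rfl
    rw [h1]
    simp only [L]
    rcases lt_trichotomy i j with h | h | h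
    · simp [h]
    · simp [h, hdiag]
    · simp [h, h.not_gt, hsymm i j, CharTwo.neg_eq]
  rw [← hLN, ← RingHom.mapMatrix_apply, ← RingHom.map_det, hdet, map_zero]

/-- A subgroup of `GL_n(𝔽₂)`, `n` odd, that is transitive on nonzero vectors and on nonzero linear
forms and contains a transvection is everything. -/
theorem eq_top_of_hasTransvection (hn : Odd n)
    (hV : ∀ v w : Fin n → ZMod 2, v ≠ 0 → w ≠ 0 → ∃ M ∈ H, M.1 *ᵥ v = w)
    (hD : ∀ h k : Fin n → ZMod 2, h ≠ 0 → k ≠ 0 → ∃ M ∈ H, h ᵥ* M.1 = k)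
    (hT : ∃ P h, P ≠ 0 ∧ h ≠ 0 ∧ HasTransvection H P h) : H = ⊤ := by
  classical
  suffices hall : ∀ P k : Fin n → ZMod 2, k ⬝ᵥ P = 0 → HasTransvection H P k by
    rw [eq_top_iff]
    rintro M -
    obtain ⟨N, hN, hNM⟩ : ∃ N ∈ H, N.1 = M.1 := by
      refine diagonal_transvection_induction_of_det_ne_zero (fun M => ∃ N ∈ H, N.1 = M) M.1
        (M.isUnit.map (detMonoidHom)).ne_zero ?_ ?_ ?_
      · intro D hD
        refine ⟨1, H.one_mem, ?_⟩
        rw [det_diagonal, Finset.prod_ne_zero_iff] at hD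
        have : D = 1 := by
          ext i; exact (zmod_two_eq_zero_or_one _).resolve_left (hD i (Finset.mem_univ i))
        rw [this]; simp
      · rintro ⟨i, j, hij, c⟩
        obtain ⟨-, N, hN, hN'⟩ := hall (Pi.single i c) (Pi.single j 1) (by simp [hij.symm])
        refine ⟨N, hN, hN'.trans ?_⟩
        simp only [TransvectionStruct.toMatrix, transvection]
        congr 1
        ext a b
        simp [vecMulVec_apply, Matrix.single_apply, Pi.single_apply, eq_comm, ← ite_and, and_comm]
      · rintro A B - - ⟨N, hN, rfl⟩ ⟨N', hN', rfl⟩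
        exact ⟨N * N', H.mul_mem hN hN', by simp⟩
    rwa [← Units.ext hNM]
  by_contra! hne
  obtain ⟨P₁, k₁, hk₁, hTk₁⟩ := hne
  have hk₁0 : k₁ ≠ 0 := by rintro rfl; exact hTk₁ (.zero_right _)
  have hout : ∀ k : Fin n → ZMod 2, k ≠ 0 → ∃ R, k ⬝ᵥ R = 0 ∧ ¬ HasTransvection H R k := by
    intro k hk
    obtain ⟨N, hN, rfl⟩ := hD k₁ k hk₁0 hk
    have hNN : N.1 * N⁻¹.1 = 1 := by
      rw [← Units.val_mul, mul_inv_cancel, Units.val_one]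
    refine ⟨N⁻¹.1 *ᵥ P₁, ?_, fun hR => hTk₁ ?_⟩
    · rw [← dotProduct_mulVec, mulVec_mulVec, hNN, one_mulVec, hk₁]
    · have := hR.conj hN
      rwa [mulVec_mulVec, hNN, one_mulVec, vecMul_vecMul, hNN, vecMul_one] at this
  let S : (Fin n → ZMod 2) → Finset (Fin n → ZMod 2) := fun P =>
    Finset.univ.filter (HasTransvection H P)
  have hcard_le : ∀ P Q, P ≠ 0 → Q ≠ 0 → (S P).card ≤ (S Q).card := by
    intro P Q hP hQ
    obtain ⟨N, hN, rfl⟩ := hV P Q hP hQ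
    refine Finset.card_le_card_of_injOn (fun h => h ᵥ* N⁻¹.1) ?_ ?_
    · intro h hh
      simp only [S, Finset.coe_filter, Finset.mem_univ, true_and, Set.mem_ofPred_eq] at hh ⊢
      exact hh.conj hN
    · intro a _ b _ hab
      have h1 := congrArg (· ᵥ* N.1) hab
      simpa only [vecMul_vecMul, ← Units.val_mul, inv_mul_cancel,
        Units.val_one, vecMul_one] using h1
  have hsym : ∀ P Q, P ≠ 0 → Q ≠ 0 → (∀ h, HasTransvection H P h → h ⬝ᵥ Q = 0) →
      ∀ k, HasTransvection H Q k → k ⬝ᵥ P = 0 := by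
    intro P Q hP hQ hPQ k hk
    by_contra hkP
    have hkP := (zmod_two_eq_zero_or_one _).resolve_left hkP
    refine (Finset.card_lt_card (s := S P) (t := S Q) ?_).not_ge (hcard_le Q P hQ hP)
    rw [Finset.ssubset_iff_of_subset]
    · refine ⟨k, by simpa [S] using hk, fun hk' => ?_⟩
      have := (Finset.mem_filter.mp hk').2.1
      rw [hkP] at this
      exact one_ne_zero this
    · intro h hh
      simp only [S, Finset.mem_filter, Finset.mem_univ, true_and] at hh ⊢
      exact hk.of_dotProduct hh hkP (hPQ h hh)
  have horth : ∀ Q k, Q ≠ 0 → k ≠ 0 → HasTransvection H Q k → ∀ P, k ⬝ᵥ P = 0 →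
      ∀ h, HasTransvection H Q h → h ⬝ᵥ P = 0 := by
    intro Q k hQ hk hQk
    have hbad : ∀ P, k ⬝ᵥ P = 0 → ¬ HasTransvection H P k →
        ∀ h, HasTransvection H Q h → h ⬝ᵥ P = 0 := by
      intro P hkP hPk
      have hP : P ≠ 0 := by rintro rfl; exact hPk (.zero_left _)
      refine hsym P Q hP hQ fun h hh => ?_
      by_contra hhQ
      exact hPk (hh.of_dotProduct hQk ((zmod_two_eq_zero_or_one _).resolve_left hhQ) hkP)
    intro P hkP h hh
    by_cases hPk : HasTransvection H P k
    · obtain ⟨R, hkR, hRk⟩ := hout k hk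
      have h1 := hbad R hkR hRk h hh
      have h2 := hbad (P + R) (by rw [dotProduct_add, hkP, hkR, add_zero]) (fun h' => hRk (by
        have := hPk.add_left h'
        rwa [← add_assoc, add_self_vec, zero_add] at this)) h hh
      rwa [dotProduct_add, h1, add_zero] at h2
    · exact hbad P hkP hPk h hh
  have hex : ∀ Q : Fin n → ZMod 2, ∃ k, HasTransvection H Q k ∧
      (Q ≠ 0 → k ≠ 0 ∧ ∀ h, HasTransvection H Q h → h = 0 ∨ h = k) := by
    intro Q
    by_cases hQ : Q = 0
    · exact ⟨0, .zero_right _, fun h => (h hQ).elim⟩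
    obtain ⟨P, h, hP, hh, hPh⟩ := hT
    obtain ⟨N, hN, rfl⟩ := hV P Q hP hQ
    have hne : h ᵥ* N⁻¹.1 ≠ 0 := by
      intro h0
      apply hh
      have h1 := congrArg (· ᵥ* N.1) h0
      simpa only [vecMul_vecMul, ← Units.val_mul, inv_mul_cancel,
        Units.val_one, vecMul_one, zero_vecMul] using h1
    have hc := hPh.conj hN
    exact ⟨_, hc, fun _ => ⟨hne, fun h' hh' => eq_zero_or_eq_of_forall_dotProduct hne
      fun P hP => horth _ _ hQ hne hc P hP h' hh'⟩⟩
  choose η hη hη' using hex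
  have hηsymm : ∀ P Q, P ≠ 0 → Q ≠ 0 → η P ⬝ᵥ Q = 0 → η Q ⬝ᵥ P = 0 := by
    intro P Q hP hQ h0
    refine hsym P Q hP hQ (fun h hh => ?_) _ (hη Q)
    rcases (hη' P hP).2 h hh with rfl | rfl
    · simp
    · exact h0
  have hηeq : ∀ P Q, P ≠ 0 → Q ≠ 0 → η P ⬝ᵥ Q = η Q ⬝ᵥ P := by
    intro P Q hP hQ
    rcases zmod_two_eq_zero_or_one (η P ⬝ᵥ Q) with h | h
    · rw [h, hηsymm P Q hP hQ h]
    · rcases zmod_two_eq_zero_or_one (η Q ⬝ᵥ P) with h' | h'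
      · rw [h', hηsymm Q P hQ hP h']
      · rw [h, h']
  have he : ∀ i : Fin n, (Pi.single i 1 : Fin n → ZMod 2) ≠ 0 := fun i => by simp
  obtain ⟨v, hv, hNv⟩ := exists_mulVec_eq_zero_of_alternating hn
    (fun i j => η (Pi.single i 1) j)
    (fun i j => by simpa using hηeq (Pi.single i 1) (Pi.single j 1) (he i) (he j))
    (fun i => by simpa using (hη (Pi.single i 1)).1)
  refine (hη' v hv).1 (funext fun i => ?_)
  have h1 := congrFun hNv i
  have h2 := hηeq v (Pi.single i 1) hv (he i)
  rw [dotProduct_single, mul_one] at h2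
  exact h2.trans h1

end Transvections

section ProjectiveSpace

/-! ### Groups acting on the incidence geometry of points and hyperplanes over `𝔽₂` -/

open Matrix

variable {n : ℕ}

lemma exists_hasTransvection_of_fixed {H : Subgroup (GL (Fin n) (ZMod 2))}
    {M : GL (Fin n) (ZMod 2)} (hM : M ∈ H) (hM1 : M ≠ 1) (S : Finset (Fin n → ZMod 2))
    (hS : ∀ v ∈ S, M.1 *ᵥ v = v) (hcard : 2 ^ n ≤ 2 * S.card) :
    ∃ P h, P ≠ 0 ∧ h ≠ 0 ∧ HasTransvection H P h := by
  classical
  obtain ⟨v₀, hv₀⟩ : ∃ v, M.1 *ᵥ v ≠ v := by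
    by_contra! hall
    exact hM1 (Units.ext (ext_of_mulVec_single fun i => by rw [hall, Units.val_one, one_mulVec]))
  set P := M.1 *ᵥ v₀ - v₀ with hP
  have hP0 : P ≠ 0 := sub_ne_zero.mpr hv₀
  have htwo : ∀ v, M.1 *ᵥ v - v = 0 ∨ M.1 *ᵥ v - v = P := by
    have hdisj : Disjoint S (S.image (· + v₀)) := by
      rw [Finset.disjoint_left]
      rintro v hv hv'
      obtain ⟨w, hw, rfl⟩ := Finset.mem_image.mp hv'
      have h1 := hS _ hv
      rw [mulVec_add, hS w hw] at h1
      exact hv₀ (add_left_cancel h1)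
    have hunion : S ∪ S.image (· + v₀) = Finset.univ := by
      apply Finset.eq_univ_of_card
      refine le_antisymm (Finset.card_le_univ _) ?_
      rw [Finset.card_union_of_disjoint hdisj,
        Finset.card_image_of_injective _ (add_left_injective v₀)]
      simp only [Fintype.card_pi, ZMod.card, Finset.prod_const, Finset.card_univ,
        Fintype.card_fin]
      omega
    intro v
    have hv := Finset.mem_univ v
    rw [← hunion, Finset.mem_union, Finset.mem_image] at hv
    rcases hv with hv | ⟨w, hw, rfl⟩
    · left; rw [hS v hv, sub_self]
    · right; rw [mulVec_add, hS w hw, hP]; abel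
  let h : Fin n → ZMod 2 := fun j => if M.1 *ᵥ Pi.single j 1 - Pi.single j 1 = 0 then 0 else 1
  have hMh : M.1 = 1 + vecMulVec P h := by
    rw [← sub_eq_iff_eq_add']
    refine ext_of_mulVec_single fun j => ?_
    rw [sub_mulVec, one_mulVec, vecMulVec_mulVec, dotProduct_single, mul_one]
    simp only [h]
    rcases htwo (Pi.single j 1) with h1 | h1
    · rw [if_pos h1, h1]; simp
    · rw [if_neg (by rwa [h1]), h1]; simp
  refine ⟨P, h, hP0, ?_, ?_, M, hM, hMh⟩
  · rintro h0
    rw [h0, vecMulVec_zero, add_zero] at hMh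
    exact hM1 (Units.ext hMh)
  · refine (zmod_two_eq_zero_or_one _).resolve_right fun h1 => hP0 ?_
    have h2 : M.1 *ᵥ P = 0 := by
      rw [hMh, add_mulVec, one_mulVec, vecMulVec_mulVec, h1]
      rw [MulOpposite.op_one, one_smul, add_self_vec]
    have h3 := congrArg (M⁻¹.1 *ᵥ ·) h2
    simpa only [mulVec_mulVec, Units.inv_mul, one_mulVec, mulVec_zero] using h3

variable {G X Y : Type*} [Group G] [MulAction G X] [MulAction G Y]

/-- The permutation of all vectors induced by an action on the nonzero vectors. -/
def vecAction (e : {v : Fin n → ZMod 2 // v ≠ 0} ≃ X) (g : G) (v : Fin n → ZMod 2) :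
    Fin n → ZMod 2 :=
  open Classical in if h : v = 0 then 0 else (e.symm (g • e ⟨v, h⟩)).1

section

variable (e : {v : Fin n → ZMod 2 // v ≠ 0} ≃ X)

@[simp] lemma vecAction_zero (g : G) : vecAction e g 0 = 0 := by simp [vecAction]

lemma vecAction_coe (g : G) (v : {v : Fin n → ZMod 2 // v ≠ 0}) :
    vecAction e g v = (e.symm (g • e v)).1 := by simp [vecAction, v.2]

lemma vecAction_mul (g g' : G) (v : Fin n → ZMod 2) :
    vecAction e (g * g') v = vecAction e g (vecAction e g' v) := by
  by_cases hv : v = 0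
  · simp [hv]
  · lift v to {v : Fin n → ZMod 2 // v ≠ 0} using hv
    simp [vecAction_coe, mul_smul]

lemma vecAction_one (v : Fin n → ZMod 2) : vecAction e (1 : G) v = v := by
  by_cases hv : v = 0
  · simp [hv]
  · lift v to {v : Fin n → ZMod 2 // v ≠ 0} using hv
    simp [vecAction_coe]

lemma vecAction_inv_apply (g : G) (v : Fin n → ZMod 2) :
    vecAction e g (vecAction e g⁻¹ v) = v := by
  rw [← vecAction_mul, mul_inv_cancel, vecAction_one]

lemma vecAction_transitive [MulAction.IsPretransitive G X] {v w : Fin n → ZMod 2} (hv : v ≠ 0)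
    (hw : w ≠ 0) : ∃ g : G, vecAction e g v = w := by
  obtain ⟨g, hg⟩ := MulAction.exists_smul_eq G (e ⟨v, hv⟩) (e ⟨w, hw⟩)
  exact ⟨g, by simp [vecAction, hv, hg]⟩

end

section

variable (e : {v : Fin n → ZMod 2 // v ≠ 0} ≃ X) (e' : {v : Fin n → ZMod 2 // v ≠ 0} ≃ Y)
  {I : X → Y → Prop} (hI : ∀ v h, I (e v) (e' h) ↔ h.1 ⬝ᵥ v.1 = 0)
  (hG : ∀ (g : G) x y, I x y → I (g • x) (g • y))
include hI hG

lemma vecAction_dotProduct (g : G) (v h : Fin n → ZMod 2) :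
    vecAction e' g h ⬝ᵥ vecAction e g v = h ⬝ᵥ v := by
  by_cases hv : v = 0
  · simp [hv]
  by_cases hh : h = 0
  · simp [hh]
  lift v to {v : Fin n → ZMod 2 // v ≠ 0} using hv
  lift h to {v : Fin n → ZMod 2 // v ≠ 0} using hh
  have key : vecAction e' g h ⬝ᵥ vecAction e g v = 0 ↔ h.1 ⬝ᵥ v.1 = 0 := by
    rw [vecAction_coe, vecAction_coe, ← hI, ← hI, Equiv.apply_symm_apply, Equiv.apply_symm_apply]
    exact ⟨fun h => by simpa using hG g⁻¹ _ _ h, hG g _ _⟩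
  rcases zmod_two_eq_zero_or_one (h.1 ⬝ᵥ v.1) with h0 | h0
  · rw [h0, key, h0]
  · rw [h0]
    exact (zmod_two_eq_zero_or_one _).resolve_left fun h1 => by simp [key.mp h1] at h0

lemma vecAction_add (g : G) (v w : Fin n → ZMod 2) :
    vecAction e g (v + w) = vecAction e g v + vecAction e g w := by
  rw [← sub_eq_zero]
  refine dotProduct_eq_zero _ fun h => ?_
  rw [dotProduct_comm, ← vecAction_inv_apply e' g h]
  simp only [dotProduct_sub, dotProduct_add, vecAction_dotProduct e e' hI hG, sub_self]

/-- A group acting compatibly on the points and the hyperplanes of a projective space of even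
dimension over `𝔽₂`, transitively on both, one of whose elements fixes at least half of the affine
space pointwise without acting trivially on the points, induces the full general linear group. -/
theorem exists_surjective_generalLinearGroup (hn : Odd n) [MulAction.IsPretransitive G X]
    [MulAction.IsPretransitive G Y]
    (hfix : ∃ (g : G) (S : Finset X), (∀ x ∈ S, g • x = x) ∧ 2 ^ n ≤ 2 * (S.card + 1) ∧
      ∃ x : X, g • x ≠ x) :
    ∃ ρ : G →* GL (Fin n) (ZMod 2), Function.Surjective ρ ∧
      ∀ g, ρ g = 1 ↔ ∀ x : X, g • x = x := by
  classical
  let L : G → (Fin n → ZMod 2) →ₗ[ZMod 2] (Fin n → ZMod 2) := fun g =>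
    AddMonoidHom.toZModLinearMap 2
      { toFun := vecAction e g
        map_zero' := vecAction_zero e g
        map_add' := vecAction_add e e' hI hG g }
  have hL : ∀ g v, L g v = vecAction e g v := fun g v => rfl
  let ρ₀ : G →* Matrix (Fin n) (Fin n) (ZMod 2) :=
    { toFun := fun g => LinearMap.toMatrix' (L g)
      map_one' := by
        rw [← LinearMap.toMatrix'_one]
        congr 1
        exact LinearMap.ext fun v => vecAction_one e v
      map_mul' := fun g g' => by
        rw [← LinearMap.toMatrix'_mul]
        congr 1
        exact LinearMap.ext fun v => vecAction_mul e g g' v }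
  let ρ : G →* GL (Fin n) (ZMod 2) := ρ₀.toHomUnits
  have hρ : ∀ g v, (ρ g).1 *ᵥ v = vecAction e g v := fun g v => by
    change LinearMap.toMatrix' (L g) *ᵥ v = _
    rw [LinearMap.toMatrix'_mulVec, hL]
  have hρ' : ∀ g h, h ᵥ* (ρ g).1 = vecAction e' g⁻¹ h := fun g h => by
    refine dotProduct_eq _ _ fun v => ?_
    rw [← dotProduct_mulVec, hρ]
    conv_lhs => rw [← vecAction_inv_apply e' g h]
    rw [vecAction_dotProduct e e' hI hG]
  have hker : ∀ g, ρ g = 1 ↔ ∀ x : X, g • x = x := by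
    intro g
    constructor
    · intro h x
      have h1 := hρ g (e.symm x).1
      rw [h, vecAction_coe, Units.val_one, one_mulVec, Equiv.apply_symm_apply] at h1
      exact (e.symm.injective (Subtype.ext h1)).symm
    · intro h
      refine Units.ext (ext_of_mulVec_single fun i => ?_)
      rw [hρ, Units.val_one, one_mulVec]
      have hi : (Pi.single i 1 : Fin n → ZMod 2) ≠ 0 := by simp
      rw [vecAction_coe e g ⟨_, hi⟩, h, Equiv.symm_apply_apply]
  refine ⟨ρ, MonoidHom.range_eq_top.mp (eq_top_of_hasTransvection hn ?_ ?_ ?_), hker⟩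
  · intro v w hv hw
    obtain ⟨g, hg⟩ := vecAction_transitive (G := G) e hv hw
    exact ⟨ρ g, ⟨g, rfl⟩, (hρ g v).trans hg⟩
  · intro h k hh hk
    obtain ⟨g, hg⟩ := vecAction_transitive (G := G) e' hh hk
    exact ⟨ρ g⁻¹, ⟨g⁻¹, rfl⟩, by rw [hρ', inv_inv, hg]⟩
  · obtain ⟨g, S, hS, hcard, x, hx⟩ := hfix
    refine exists_hasTransvection_of_fixed (M := ρ g) ⟨g, rfl⟩ (fun h => hx ((hker g).mp h x))
      (insert 0 (S.image fun x => (e.symm x).1)) ?_ ?_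
    · intro v hv
      rw [hρ]
      rcases Finset.mem_insert.mp hv with rfl | hv
      · simp
      · obtain ⟨x, hx, rfl⟩ := Finset.mem_image.mp hv
        rw [vecAction_coe, Equiv.apply_symm_apply, hS x hx]
    · rwa [Finset.card_insert_of_notMem, Finset.card_image_of_injective]
      · exact Subtype.val_injective.comp e.symm.injective
      · simp only [Finset.mem_image, not_exists, not_and]
        exact fun x _ => (e.symm x).2

end

end ProjectiveSpace

section SpecialLinear

open Matrix

/-- Over `𝔽₂` the general linear group coincides with the projective special linear group. -/
theorem nonempty_generalLinearGroup_mulEquiv (n : ℕ) :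
    Nonempty (GL (Fin n) (ZMod 2) ≃* ProjectiveSpecialLinearGroup (Fin n) (ZMod 2)) := by
  have hbij : Function.Bijective (SpecialLinearGroup.toGL (n := Fin n) (R := ZMod 2)) := by
    constructor
    · intro A B h
      exact Subtype.ext (congrArg Units.val h)
    · intro M
      refine ⟨⟨M.1, (zmod_two_eq_zero_or_one _).resolve_left
        (M.isUnit.map detMonoidHom).ne_zero⟩, ?_⟩
      exact Units.ext rfl
  have hcenter : Subgroup.center (SpecialLinearGroup (Fin n) (ZMod 2)) = ⊥ := by
    rw [Subgroup.eq_bot_iff_forall]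
    intro A hA
    obtain ⟨r, hr, hA⟩ := Matrix.SpecialLinearGroup.mem_center_iff.mp hA
    rcases zmod_two_eq_zero_or_one r with rfl | rfl
    · rcases Nat.eq_zero_or_pos n with rfl | hn
      · exact Subsingleton.elim _ _
      · rw [Fintype.card_fin, zero_pow hn.ne'] at hr
        exact (zero_ne_one hr).elim
    · exact Subtype.ext (hA.symm.trans (by simp))
  exact ⟨(MulEquiv.ofBijective _ hbij).symm.trans
    ((QuotientGroup.quotientBot (G := SpecialLinearGroup (Fin n) (ZMod 2))).symm.trans
      (QuotientGroup.quotientMulEquivOfEq hcenter.symm))⟩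

end SpecialLinear

section GaloisGroup

open Matrix

lemma map_evalList {R R' : Type*} [CommRing R] [CommRing R'] (φ : R →+* R') (s y : R)
    (u : List (ℤ × ℤ)) : φ (evalList s y u) = evalList (φ s) (φ y) u := by
  induction u with
  | nil => simp
  | cons c u ih => simp [ih]

lemma map_evalTable {R R' : Type*} [CommRing R] [CommRing R'] (φ : R →+* R') (s x y : R)
    (u : List (List (ℤ × ℤ))) : φ (evalTable s x y u) = evalTable (φ s) (φ x) (φ y) u := by
  induction u with
  | nil => simp
  | cons c u ih => simp [ih, map_evalList]

variable {F : Type*} [Field F]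

lemma exists_fixed_of_not_splits {p : F[X]} {E : Type*} [Field E] [Algebra F E]
    [Fact (p.map (algebraMap F E)).Splits] {L : Type*} [Field L] [CharZero L] [Algebra F L]
    (hL : ¬ (p.map (algebraMap F L)).Splits) (S : Finset L)
    (hS : ∀ a ∈ S, a ∈ p.rootSet L) :
    ∃ (τ : p.Gal) (S' : Finset (p.rootSet E)), (∀ x ∈ S', τ • x = x) ∧ S'.card = S.card ∧
      ∃ x : p.rootSet E, τ • x ≠ x := by
  classical
  set p' := p.map (algebraMap F L) with hp'
  let E' := p'.SplittingField
  have hsplit : (p.map (algebraMap F E')).Splits := by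
    have := SplittingField.splits p'
    rwa [hp', Polynomial.map_map, ← IsScalarTower.algebraMap_eq] at this
  have : Fact (p.map (algebraMap F E')).Splits := ⟨hsplit⟩
  have hp0 : p ≠ 0 := by rintro rfl; simp [hp'] at hL
  have hroot : ∀ {y : E'}, y ∈ p'.rootSet E' → y ∈ p.rootSet E' := by
    intro y hy
    rw [mem_rootSet_of_ne hp0]
    have h := (mem_rootSet.mp hy).2
    exact (aeval_map_algebraMap L y p).symm.trans h
  have : IsGalois L E' := ⟨⟩
  obtain ⟨σ, hσ⟩ : ∃ σ : p'.Gal, σ ≠ 1 := by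
    by_contra! hall
    refine hL ((IsSplittingField.splits_iff E' p').mpr ?_)
    rw [eq_comm, ← top_le_iff]
    rintro x -
    rw [Algebra.mem_bot, IsGalois.mem_range_algebraMap_iff_fixed]
    intro σ
    rw [hall σ]; rfl
  obtain ⟨y, hy, hσy⟩ : ∃ y ∈ p'.rootSet E', σ y ≠ y := by
    by_contra! hall
    exact hσ (Gal.ext p' hall)
  let τ : p.Gal := Gal.restrict p E' (AlgEquiv.restrictScalars F σ)
  let e : p.rootSet E' ≃ p.rootSet E :=
    (Gal.rootsEquivRoots p E').symm.trans (Gal.rootsEquivRoots p E)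
  have he : ∀ x, τ • e x = e (τ • x) := by
    intro x
    simp [e, Gal.smul_def]
  have hτ : ∀ x : p.rootSet E', ((τ • x : p.rootSet E') : E') = σ x := fun x =>
    Gal.restrict_smul _ x
  have hSmem : ∀ a : S, algebraMap L E' a ∈ p.rootSet E' := by
    intro a
    have := (mem_rootSet_of_ne hp0).mp (hS a a.2)
    rw [mem_rootSet_of_ne hp0, aeval_algebraMap_apply, this, map_zero]
  refine ⟨τ, Finset.univ.image fun a : S => e ⟨_, hSmem a⟩, ?_, ?_, e ⟨y, hroot hy⟩, ?_⟩
  · intro x hx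
    obtain ⟨a, -, rfl⟩ := Finset.mem_image.mp hx
    rw [he]
    congr 1
    apply Subtype.ext
    rw [hτ]
    exact σ.commutes a
  · rw [Finset.card_image_of_injective, Finset.card_univ, Fintype.card_coe]
    intro a b hab
    exact Subtype.ext ((algebraMap L E').injective (Subtype.ext_iff.mp (e.injective hab)))
  · intro h
    rw [he] at h
    exact hσy ((hτ _).symm.trans (congrArg Subtype.val (e.injective h)))

/-- The Galois group of an irreducible polynomial `p` is the full linear group over `𝔽₂` if its
roots can be identified with the points and those of another irreducible polynomial with the
hyperplanes of a projective space of even dimension over `𝔽₂`, incidence being an algebraic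
relation over the ground field, and if over some extension field `p` does not split although it
has as many roots as a hyperplane has points. -/
theorem nonempty_gal_mulEquiv_generalLinearGroup {p q : F[X]} (hp : Irreducible p)
    (hq : Irreducible q) {n : ℕ} (hn : Odd n) (s : F) (u : List (List (ℤ × ℤ)))
    {L₁ : Type*} [Field L₁] [Algebra F L₁] (hpL : (p.map (algebraMap F L₁)).Splits)
    (hqL : (q.map (algebraMap F L₁)).Splits)
    (e : {v : Fin n → ZMod 2 // v ≠ 0} ≃ p.rootSet L₁)
    (e' : {v : Fin n → ZMod 2 // v ≠ 0} ≃ q.rootSet L₁)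
    (hI : ∀ v h, evalTable (algebraMap F L₁ s) (e v : L₁) (e' h : L₁) u = 0 ↔ h.1 ⬝ᵥ v.1 = 0)
    {L₂ : Type*} [Field L₂] [CharZero L₂] [Algebra F L₂]
    (hL₂ : ¬ (p.map (algebraMap F L₂)).Splits) (S : Finset L₂)
    (hS : ∀ a ∈ S, a ∈ p.rootSet L₂) (hcard : 2 ^ n ≤ 2 * (S.card + 1)) :
    Nonempty (p.Gal ≃* GL (Fin n) (ZMod 2)) := by
  classical
  let E := (p * q).SplittingField
  have hpq : p * q ≠ 0 := mul_ne_zero hp.ne_zero hq.ne_zero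
  have hE := SplittingField.splits (p * q)
  have hpE : Fact (p.map (algebraMap F E)).Splits :=
    ⟨hE.of_dvd (map_ne_zero hpq) (Polynomial.map_dvd _ (dvd_mul_right p q))⟩
  have hqE : Fact (q.map (algebraMap F E)).Splits :=
    ⟨hE.of_dvd (map_ne_zero hpq) (Polynomial.map_dvd _ (dvd_mul_left q p))⟩
  let ψ : E →ₐ[F] L₁ := SplittingField.lift (p * q) (by
    rw [Polynomial.map_mul]; exact hpL.mul hqL)
  have hbij : ∀ r : F[X], (r.map (algebraMap F E)).Splits → Function.Bijective
      (Set.MapsTo.restrict ψ (r.rootSet E) (r.rootSet L₁) (rootSet_mapsTo ψ)) := by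
    intro r hr
    refine ⟨fun a b hab => Subtype.ext (ψ.injective (Subtype.ext_iff.mp hab)), fun b => ?_⟩
    have hb : (b : L₁) ∈ ψ '' r.rootSet E := by
      rw [hr.image_rootSet ψ]
      exact b.2
    obtain ⟨a, ha, hab⟩ := hb
    exact ⟨⟨a, ha⟩, Subtype.ext hab⟩
  let eX := e.trans (Equiv.ofBijective _ (hbij p hpE.1)).symm
  let eY := e'.trans (Equiv.ofBijective _ (hbij q hqE.1)).symm
  have heX : ∀ v, ψ (eX v) = e v := fun v =>
    congrArg Subtype.val ((Equiv.ofBijective _ (hbij p hpE.1)).apply_symm_apply (e v))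
  have heY : ∀ v, ψ (eY v) = e' v := fun v =>
    congrArg Subtype.val ((Equiv.ofBijective _ (hbij q hqE.1)).apply_symm_apply (e' v))
  let actX : MulAction Gal(E/F) (p.rootSet E) := MulAction.compHom _ (Gal.restrict p E)
  let actY : MulAction Gal(E/F) (q.rootSet E) := MulAction.compHom _ (Gal.restrict q E)
  have hX : ∀ (g : Gal(E/F)) (x : p.rootSet E), ((g • x : p.rootSet E) : E) = g x := fun g x =>
    Gal.restrict_smul g x
  have hY : ∀ (g : Gal(E/F)) (x : q.rootSet E), ((g • x : q.rootSet E) : E) = g x := fun g x =>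
    Gal.restrict_smul g x
  have hnormal : Normal F E := inferInstance
  have hsurjX := Gal.restrict_surjective p E
  have hsurjY := Gal.restrict_surjective q E
  have htX : MulAction.IsPretransitive Gal(E/F) (p.rootSet E) := ⟨fun x y => by
    obtain ⟨τ, hτ⟩ := (Gal.galAction_isPretransitive p E hp).exists_smul_eq x y
    obtain ⟨g, rfl⟩ := hsurjX τ
    exact ⟨g, hτ⟩⟩
  have htY : MulAction.IsPretransitive Gal(E/F) (q.rootSet E) := ⟨fun x y => by
    obtain ⟨τ, hτ⟩ := (Gal.galAction_isPretransitive q E hq).exists_smul_eq x y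
    obtain ⟨g, rfl⟩ := hsurjY τ
    exact ⟨g, hτ⟩⟩
  obtain ⟨τ, S', hS', hS'card, x, hx⟩ := exists_fixed_of_not_splits (E := E) hL₂ S hS
  obtain ⟨g, rfl⟩ := hsurjX τ
  obtain ⟨ρ, hρ, hker⟩ := exists_surjective_generalLinearGroup (G := Gal(E/F)) eX eY
    (I := fun x y => evalTable (algebraMap F E s) (x : E) (y : E) u = 0)
    (fun v h => by
      rw [← hI, ← heX, ← heY, ← ψ.commutes s]
      have := map_evalTable ψ.toRingHom (algebraMap F E s) (eX v : E) (eY h : E) u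
      simp only [AlgHom.toRingHom_eq_coe, RingHom.coe_coe] at this
      rw [← this, map_eq_zero])
    (fun g x y hxy => by
      have := map_evalTable (g : E →+* E) (algebraMap F E s) (x : E) (y : E) u
      rw [hxy, map_zero] at this
      simp only [RingHom.coe_coe, AlgEquiv.commutes] at this
      rw [hX, hY, ← this])
    hn ⟨g, S', hS', by rwa [hS'card], x, hx⟩
  have hkers : (Gal.restrict p E).ker = ρ.ker := by
    ext g
    rw [MonoidHom.mem_ker, MonoidHom.mem_ker, hker]
    constructor
    · intro h x
      change Gal.restrict p E g • x = x
      rw [h, one_smul]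
    · intro h
      refine Gal.galActionHom_injective p E (Equiv.ext fun x => ?_)
      rw [map_one]
      exact h x
  exact ⟨(QuotientGroup.quotientKerEquivOfSurjective _ hsurjX).symm.trans
    ((QuotientGroup.quotientMulEquivOfEq hkers).trans
      (QuotientGroup.quotientKerEquivOfSurjective _ hρ))⟩

end GaloisGroup

section Reduction

/-! ### Evaluation modulo a prime with natural numbers -/

/-- The value at `y` modulo `l` of a list of coefficients. -/
def horner (l y : ℕ) (u : List ℕ) : ℕ := u.foldr (fun c r => (c + y * r) % l) 0

lemma horner_lt {l : ℕ} (hl : 0 < l) (y : ℕ) (u : List ℕ) : horner l y u < l := by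
  cases u with
  | nil => exact hl
  | cons c u => exact Nat.mod_lt _ hl

/-- The reduction modulo `l` of a coefficient list, with `s` in the role of `√-7`. -/
def reduceList (l s : ℕ) (u : List (ℤ × ℤ)) : List ℕ :=
  u.map fun c => ((c.1 + c.2 * (s : ℤ)) % (l : ℤ)).toNat

/-- The reduction modulo `l` of a bivariate coefficient list after substituting a value for `y`. -/
def partialEval (l s y : ℕ) (u : List (List (ℤ × ℤ))) : List ℕ :=
  u.map fun c => horner l y (reduceList l s c)

lemma cast_horner (l y : ℕ) (u : List ℕ) :
    ((horner l y u : ℕ) : ZMod l) = u.foldr (fun (c : ℕ) r => (c : ZMod l) + y * r) 0 := by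
  induction u with
  | nil => simp [horner]
  | cons c u ih =>
    rw [horner] at ih
    simp [horner, ih]

lemma cast_horner_reduceList {l : ℕ} [NeZero l] (s y : ℕ) (u : List (ℤ × ℤ)) :
    ((horner l y (reduceList l s u) : ℕ) : ZMod l) = evalList (s : ZMod l) y u := by
  rw [cast_horner]
  induction u with
  | nil => rfl
  | cons c u ih =>
    have h : ((((c.1 + c.2 * (s : ℤ)) % (l : ℤ)).toNat : ℕ) : ZMod l) = c.1 + c.2 * s := by
      rw [← Int.cast_natCast, Int.toNat_of_nonneg
        (Int.emod_nonneg _ (Nat.cast_ne_zero.mpr (NeZero.ne l))), ZMod.intCast_mod]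
      push_cast
      rfl
    rw [reduceList, List.map_cons, List.foldr_cons, h, evalList_cons, ← ih, reduceList]

lemma cast_horner_partialEval {l : ℕ} [NeZero l] (s x y : ℕ) (u : List (List (ℤ × ℤ))) :
    ((horner l x (partialEval l s y u) : ℕ) : ZMod l) = evalTable (s : ZMod l) x y u := by
  rw [cast_horner]
  induction u with
  | nil => rfl
  | cons c u ih =>
    rw [partialEval, List.map_cons, List.foldr_cons, cast_horner_reduceList, evalTable_cons,
      ← ih, partialEval]

/-- The points of the cover over `8698` modulo `9587`, indexed by binary vectors. -/
def pointRoots : List ℕ :=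
  [0, 464, 738, 7317, 814, 2968, 6220, 1661, 1012, 3040, 2946, 4479, 5036, 4991, 1796, 1608, 1157,
    3152, 3094, 3683, 2119, 7416, 4676, 8719, 8617, 2642, 8732, 1820, 7468, 6547, 1565, 2801]

/-- The points of the dual cover over `8698` modulo `9587`, indexed by binary vectors. -/
def hyperplaneRoots : List ℕ :=
  [0, 5386, 2448, 5053, 223, 347, 324, 3859, 7661, 3694, 4845, 8431, 8743, 6, 1512, 2626, 9229,
    9530, 3504, 7847, 3353, 1830, 401, 5253, 4133, 6987, 1902, 4220, 5530, 5652, 8565, 8876]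

/-- The pairing of two vectors over `𝔽₂` given by the binary digits of `m` and `n`. -/
def bitPairing (m n : ℕ) : ℕ :=
  (m % 2 * (n % 2) + m / 2 % 2 * (n / 2 % 2) + m / 4 % 2 * (n / 4 % 2) + m / 8 % 2 * (n / 8 % 2) +
    m / 16 % 2 * (n / 16 % 2)) % 2

lemma horner_nonincidenceTable_ne_zero : ((List.range 32).all fun m =>
    (List.range 32).all fun n => m == 0 || n == 0 || bitPairing m n == 1 ||
      horner 9587 (pointRoots.getD n 0)
        (partialEval 9587 4664 (hyperplaneRoots.getD m 0) nonincidenceTable) != 0) = true := by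
  decide +kernel

lemma horner_incidenceTable_ne_zero : ((List.range 32).all fun m =>
    (List.range 32).all fun n => m == 0 || n == 0 || bitPairing m n == 0 ||
      horner 9587 (pointRoots.getD n 0)
        (partialEval 9587 4664 (hyperplaneRoots.getD m 0) incidenceTable) != 0) = true := by
  decide +kernel

end Reduction

section CoverPolynomial

/-- The polynomial of the three-point cover over `t`, with `s` in the role of `√-7` and `h` in the
role of `1 / 2`. -/
noncomputable def coverPoly {R : Type*} [CommRing R] (s h t : R) : R[X] :=
  X ^ 21 * (X - 1) ^ 7 * (X - C ((11 - s) * h ^ 3)) ^ 3 -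
    C t * ((X ^ 2 - 2 * X + C ((11 - s) * h ^ 4)) ^ 8 *
      (X ^ 3 - 2 * X ^ 2 + C ((s + 21) * h ^ 4) * X + C ((-3 * s - 31) * h ^ 7)) ^ 4 *
        (X - C ((3 - s) * h ^ 3)))

section CommRing

variable {R : Type*} [CommRing R]

lemma map_coverPoly {R' : Type*} [CommRing R'] (φ : R →+* R') (s h t : R) :
    (coverPoly s h t).map φ = coverPoly (φ s) (φ h) (φ t) := by
  have e : ∀ n : ℕ, φ (n : R) = n := map_natCast φ
  have h3 := e 3
  have h11 := e 11
  have h21 := e 21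
  have h31 := e 31
  push_cast at h3 h11 h21 h31
  simp [coverPoly, h3, h11, h21, h31]

lemma eval_coverPoly (s h t x : R) : (coverPoly s h t).eval x =
    x ^ 21 * (x - 1) ^ 7 * (x - (11 - s) * h ^ 3) ^ 3 -
      t * ((x ^ 2 - 2 * x + (11 - s) * h ^ 4) ^ 8 *
        (x ^ 3 - 2 * x ^ 2 + (s + 21) * h ^ 4 * x + (-3 * s - 31) * h ^ 7) ^ 4 *
          (x - (3 - s) * h ^ 3)) := by
  simp [coverPoly]

lemma eval_derivative_coverPoly (s h t x : R) : (derivative (coverPoly s h t)).eval x =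
    x ^ 20 * (x - 1) ^ 6 * (x - (11 - s) * h ^ 3) ^ 2 *
        (21 * (x - 1) * (x - (11 - s) * h ^ 3) + 7 * x * (x - (11 - s) * h ^ 3) +
          3 * x * (x - 1)) -
      t * (x ^ 2 - 2 * x + (11 - s) * h ^ 4) ^ 7 *
        (x ^ 3 - 2 * x ^ 2 + (s + 21) * h ^ 4 * x + (-3 * s - 31) * h ^ 7) ^ 3 *
          (8 * (2 * x - 2) *
              (x ^ 3 - 2 * x ^ 2 + (s + 21) * h ^ 4 * x + (-3 * s - 31) * h ^ 7) *
                (x - (3 - s) * h ^ 3) +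
            4 * (x ^ 2 - 2 * x + (11 - s) * h ^ 4) * (3 * x ^ 2 - 4 * x + (s + 21) * h ^ 4) *
              (x - (3 - s) * h ^ 3) +
            (x ^ 2 - 2 * x + (11 - s) * h ^ 4) *
              (x ^ 3 - 2 * x ^ 2 + (s + 21) * h ^ 4 * x + (-3 * s - 31) * h ^ 7)) := by
  have hQ : (derivative (X ^ 2 - 2 * X + C ((11 - s) * h ^ 4))).eval x = 2 * x - 2 := by
    rw [← C_ofNat 2]
    simp only [derivative_sub, derivative_add, derivative_mul, derivative_C, derivative_X_pow,
      derivative_X, eval_sub, eval_add, eval_mul, eval_C, eval_X, eval_pow, eval_zero, eval_one]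
    push_cast
    ring
  have hR : (derivative (X ^ 3 - 2 * X ^ 2 + C ((s + 21) * h ^ 4) * X +
      C ((-3 * s - 31) * h ^ 7))).eval x = 3 * x ^ 2 - 4 * x + (s + 21) * h ^ 4 := by
    rw [← C_ofNat 2]
    simp only [derivative_sub, derivative_add, derivative_mul, derivative_C, derivative_X_pow,
      derivative_X, eval_sub, eval_add, eval_mul, eval_C, eval_X, eval_pow, eval_zero, eval_one]
    push_cast
    ring
  have hQ' : (X ^ 2 - 2 * X + C ((11 - s) * h ^ 4)).eval x = x ^ 2 - 2 * x + (11 - s) * h ^ 4 := by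
    simp
  have hR' : (X ^ 3 - 2 * X ^ 2 + C ((s + 21) * h ^ 4) * X + C ((-3 * s - 31) * h ^ 7)).eval x =
      x ^ 3 - 2 * x ^ 2 + (s + 21) * h ^ 4 * x + (-3 * s - 31) * h ^ 7 := by
    simp
  rw [coverPoly]
  generalize X ^ 2 - 2 * X + C ((11 - s) * h ^ 4) = Q at *
  generalize X ^ 3 - 2 * X ^ 2 + C ((s + 21) * h ^ 4) * X + C ((-3 * s - 31) * h ^ 7) = V at *
  simp only [derivative_sub, derivative_mul, derivative_pow, derivative_X, derivative_C,
    derivative_one, eval_sub, eval_mul, eval_add, eval_pow, eval_X, eval_C, eval_one, hQ, hR, hQ',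
    hR', eval_zero]
  generalize x ^ 2 - 2 * x + (11 - s) * h ^ 4 = q
  generalize x ^ 3 - 2 * x ^ 2 + (s + 21) * h ^ 4 * x + (-3 * s - 31) * h ^ 7 = r
  generalize 3 * x ^ 2 - 4 * x + (s + 21) * h ^ 4 = r'
  generalize (11 - s) * h ^ 3 = a
  generalize (3 - s) * h ^ 3 = b
  generalize hu : x - 1 = u
  generalize x - a = w
  generalize x - b = z
  generalize 2 * x - 2 = q'
  push_cast
  ring

lemma natDegree_and_monic_coverPoly [Nontrivial R] (s h t : R) :
    (coverPoly s h t).natDegree = 31 ∧ (coverPoly s h t).Monic := by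
  have h₁ : (X - 1 : R[X]).Monic := by simpa using monic_X_sub_C (1 : R)
  have h₁' : (X - 1 : R[X]).natDegree = 1 := by simpa using natDegree_X_sub_C (1 : R)
  have hnum : (X ^ 21 * (X - 1) ^ 7 * (X - C ((11 - s) * h ^ 3)) ^ 3 : R[X]).Monic :=
    ((monic_X_pow 21).mul (h₁.pow 7)).mul ((monic_X_sub_C _).pow 3)
  have hnum' : (X ^ 21 * (X - 1) ^ 7 * (X - C ((11 - s) * h ^ 3)) ^ 3 : R[X]).natDegree = 31 := by
    rw [((monic_X_pow 21).mul (h₁.pow 7)).natDegree_mul ((monic_X_sub_C _).pow 3),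
      (monic_X_pow 21).natDegree_mul (h₁.pow 7), h₁.natDegree_pow, (monic_X_sub_C _).natDegree_pow,
      h₁', natDegree_X_pow, natDegree_X_sub_C]
  have hden : (C t * ((X ^ 2 - 2 * X + C ((11 - s) * h ^ 4)) ^ 8 *
      (X ^ 3 - 2 * X ^ 2 + C ((s + 21) * h ^ 4) * X + C ((-3 * s - 31) * h ^ 7)) ^ 4 *
        (X - C ((3 - s) * h ^ 3))) : R[X]).natDegree ≤ 29 := by
    rw [← C_ofNat 2]
    compute_degree
  have hlt : (C t * ((X ^ 2 - 2 * X + C ((11 - s) * h ^ 4)) ^ 8 *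
      (X ^ 3 - 2 * X ^ 2 + C ((s + 21) * h ^ 4) * X + C ((-3 * s - 31) * h ^ 7)) ^ 4 *
        (X - C ((3 - s) * h ^ 3))) : R[X]).degree <
      (X ^ 21 * (X - 1) ^ 7 * (X - C ((11 - s) * h ^ 3)) ^ 3 : R[X]).degree :=
    degree_lt_degree (by omega)
  refine ⟨?_, hnum.sub_of_left hlt⟩
  rw [coverPoly, natDegree_sub_eq_left_of_natDegree_lt (by omega), hnum']

lemma two_pow_mul_num {s h : R} (hh : 2 * h = 1) (hs : s ^ 2 = -7) (x : R) :
    evalList s x numList =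
      2 ^ 9 * (x ^ 21 * (x - 1) ^ 7 * (x - (11 - s) * h ^ 3) ^ 3) := by
  have : 8 * x - 11 + s = 8 * (x - (11 - s) * h ^ 3) := by
    linear_combination (11 - s) * (4 * h ^ 2 + 2 * h + 1) * hh
  rw [evalList_numList hs, this]
  generalize (x - 1) ^ 7 = u
  generalize x - (11 - s) * h ^ 3 = w
  ring

lemma two_pow_mul_den {s h : R} (hh : 2 * h = 1) (hs : s ^ 2 = -7) (x : R) :
    evalList s x denList =
      2 ^ 63 * ((x ^ 2 - 2 * x + (11 - s) * h ^ 4) ^ 8 *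
        (x ^ 3 - 2 * x ^ 2 + (s + 21) * h ^ 4 * x + (-3 * s - 31) * h ^ 7) ^ 4 *
          (x - (3 - s) * h ^ 3)) := by
  have h3 : 2 ^ 3 * h ^ 3 = 1 := by rw [← mul_pow, hh, one_pow]
  have h4 : 2 ^ 4 * h ^ 4 = 1 := by rw [← mul_pow, hh, one_pow]
  have h7 : 2 ^ 7 * h ^ 7 = 1 := by rw [← mul_pow, hh, one_pow]
  have e₁ : 16 * x ^ 2 - 32 * x + 11 - s = 2 ^ 4 * (x ^ 2 - 2 * x + (11 - s) * h ^ 4) := by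
    linear_combination (s - 11) * h4
  have e₂ : 128 * x ^ 3 - 256 * x ^ 2 + (168 + 8 * s) * x - 31 - 3 * s =
      2 ^ 7 * (x ^ 3 - 2 * x ^ 2 + (s + 21) * h ^ 4 * x + (-3 * s - 31) * h ^ 7) := by
    linear_combination (-8 * (s + 21) * x) * h4 + (3 * s + 31) * h7
  have e₃ : 8 * x - 3 + s = 2 ^ 3 * (x - (3 - s) * h ^ 3) := by
    linear_combination (3 - s) * h3
  rw [evalList_denList hs, e₁, e₂, e₃]
  generalize x ^ 2 - 2 * x + (11 - s) * h ^ 4 = q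
  generalize x ^ 3 - 2 * x ^ 2 + (s + 21) * h ^ 4 * x + (-3 * s - 31) * h ^ 7 = r
  generalize x - (3 - s) * h ^ 3 = w
  ring

/-- A root of the polynomial of the cover and a root of that of the dual cover either are incident
or satisfy the complementary relation. -/
lemma incidence_mul_nonincidence_of_root {s h t x y : R} (hh : 2 * h = 1) (hs : s ^ 2 = -7)
    (hx : (coverPoly s h t).eval x = 0)
    (hy : (coverPoly (-s) h ((31 - 3 * s) * h ^ 5 * t)).eval y = 0) :
    evalTable s x y incidenceTable * evalTable s x y nonincidenceTable = 0 := by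
  have hs' : (-s) ^ 2 = -7 := by rw [neg_sq, hs]
  rw [eval_coverPoly] at hx hy
  have h2 : ∀ n : ℕ, h ^ n * 2 ^ n = 1 := fun n => by rw [← mul_pow, mul_comm h, hh, one_pow]
  have key := incidence_mul_nonincidence hs x y
  rw [two_pow_mul_num hh hs, two_pow_mul_den hh hs, two_pow_mul_num hh hs',
    two_pow_mul_den hh hs'] at key
  rw [← one_mul (_ * _), ← h2 17, mul_assoc, key]
  generalize x ^ 21 * (x - 1) ^ 7 * (x - (11 - s) * h ^ 3) ^ 3 = f at *
  generalize y ^ 21 * (y - 1) ^ 7 * (y - (11 - -s) * h ^ 3) ^ 3 = f' at *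
  generalize (x ^ 2 - 2 * x + (11 - s) * h ^ 4) ^ 8 *
        (x ^ 3 - 2 * x ^ 2 + (s + 21) * h ^ 4 * x + (-3 * s - 31) * h ^ 7) ^ 4 *
          (x - (3 - s) * h ^ 3) = g at *
  generalize (y ^ 2 - 2 * y + (11 - -s) * h ^ 4) ^ 8 *
        (y ^ 3 - 2 * y ^ 2 + (-s + 21) * h ^ 4 * y + (-3 * -s - 31) * h ^ 7) ^ 4 *
          (y - (3 - -s) * h ^ 3) = g' at *
  linear_combination h ^ 17 * 2 ^ 72 * (31 - 3 * s) * g' * hx - h ^ 17 * 2 ^ 77 * g * hy -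
    h ^ 17 * 2 ^ 72 * (31 - 3 * s) * t * g * g' * h2 5

end CommRing

end CoverPolynomial

section Irreducibility

variable {K : Type*} [Field K]

lemma isCoprime_X_sub_C_of_eval_ne_zero {a : K} {g : K[X]} (h : g.eval a ≠ 0) :
    IsCoprime (X - C a) g :=
  (irreducible_X_sub_C a).coprime_iff_not_dvd.mpr fun hd => h (dvd_iff_isRoot.mp hd)

/-- A polynomial `f(x) - t g(x)` with coprime `f` and `g` is irreducible over `K[t]`. -/
lemma irreducible_map_sub_C_mul_map {f g : K[X]} (hg : g ≠ 0) (hfg : IsCoprime f g) :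
    Irreducible (f.map C - C X * g.map C : K[X][X]) := by
  rw [← MulEquiv.irreducible_iff (Bivariate.swap (R := K)).toRingEquiv.toMulEquiv]
  convert irreducible_C_mul_X_add_C (neg_ne_zero.mpr hg)
    ((IsCoprime.neg_left_iff _ _).mpr hfg.symm).isRelPrime using 1
  change Bivariate.swap (f.map C - C X * g.map C) = _
  rw [map_sub, map_mul, Bivariate.swap_map_C, Bivariate.swap_map_C, Bivariate.swap_X, C_neg]
  ring

theorem irreducible_coverPoly {s h c : K} (hh : 2 * h = 1) (hs : s ^ 2 = -7) (hc : c ≠ 0) :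
    Irreducible (coverPoly (RatFunc.C s) (RatFunc.C h) (RatFunc.C c * RatFunc.X)) := by
  have h0 : h ≠ 0 := by rintro rfl; simp at hh
  have h2 : (2 : K) ≠ 0 := by rintro h2; simp [h2] at hh
  have hnorm : ∀ (a b : K) (n : ℕ), (a - b * s) * (a + b * s) = 2 ^ n → a + b * s ≠ 0 := by
    intro a b n hab h
    rw [h, mul_zero] at hab
    exact pow_ne_zero n h2 hab.symm
  set g : K[X] := (X ^ 2 - 2 * X + C ((11 - s) * h ^ 4)) ^ 8 *
    (X ^ 3 - 2 * X ^ 2 + C ((s + 21) * h ^ 4) * X + C ((-3 * s - 31) * h ^ 7)) ^ 4 *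
      (X - C ((3 - s) * h ^ 3)) with hg
  set f : K[X] := X ^ 21 * (X - 1) ^ 7 * (X - C ((11 - s) * h ^ 3)) ^ 3 with hf
  have heval : ∀ {x : K}, evalList s x denList ≠ 0 → (C c * g).eval x ≠ 0 := by
    intro x hx
    rw [two_pow_mul_den hh hs] at hx
    rw [eval_mul, eval_C]
    refine mul_ne_zero hc ?_
    convert right_ne_zero_of_mul hx using 1
    simp [hg]
  have hden : ∀ {x : K}, 16 * x ^ 2 - 32 * x + 11 - s ≠ 0 →
      128 * x ^ 3 - 256 * x ^ 2 + (168 + 8 * s) * x - 31 - 3 * s ≠ 0 → 8 * x - 3 + s ≠ 0 →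
      (C c * g).eval x ≠ 0 := by
    intro x h₁ h₂ h₃
    apply heval
    rw [evalList_denList hs]
    exact mul_ne_zero (mul_ne_zero (pow_ne_zero 8 h₁) (pow_ne_zero 4 h₂)) h₃
  have h₀ : (C c * g).eval 0 ≠ 0 := by
    apply hden
    · convert hnorm 11 (-1) 7 (by linear_combination -hs) using 1
      ring
    · convert hnorm (-31) (-3) 10 (by linear_combination -9 * hs) using 1
      ring
    · convert hnorm (-3) 1 4 (by linear_combination -hs) using 1
      ring
  have h₁ : (C c * g).eval 1 ≠ 0 := by
    apply hden
    · convert hnorm (-5) (-1) 5 (by linear_combination -hs) using 1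
      ring
    · convert hnorm 9 5 8 (by linear_combination -25 * hs) using 1
      ring
    · convert hnorm 5 1 5 (by linear_combination -hs) using 1
      ring
  have h₂ : (C c * g).eval ((11 - s) * h ^ 3) ≠ 0 := by
    have hx : 8 * ((11 - s) * h ^ 3) = 11 - s := by
      linear_combination (11 - s) * (4 * h ^ 2 + 2 * h + 1) * hh
    generalize (11 - s) * h ^ 3 = x at hx
    apply hden
    · refine right_ne_zero_of_mul (a := 4) ?_
      convert hnorm (-18) (-10) 10 (by linear_combination -100 * hs) using 1
      linear_combination (8 * x - 5 - s) * hx + hs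
    · refine right_ne_zero_of_mul (a := 4) ?_
      convert hnorm 104 (-56) 15 (by linear_combination -3136 * hs) using 1
      linear_combination ((8 * x) ^ 2 + 8 * x * (11 - s) + (11 - s) ^ 2 -
        16 * (8 * x + 11 - s) + 84 + 4 * s) * hx + (13 - s) * hs
    · convert hnorm 8 0 6 (by ring) using 1
      linear_combination hx
  have hcop : IsCoprime f (C c * g) := by
    refine IsCoprime.mul_left (IsCoprime.mul_left (IsCoprime.pow_left ?_) (IsCoprime.pow_left ?_))
      (IsCoprime.pow_left (isCoprime_X_sub_C_of_eval_ne_zero h₂))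
    · simpa using isCoprime_X_sub_C_of_eval_ne_zero h₀
    · simpa using isCoprime_X_sub_C_of_eval_ne_zero h₁
  have hP : coverPoly (C s) (C h) (C c * X) = f.map C - C X * (C c * g).map C := by
    have hf' : f.map C = X ^ 21 * (X - 1) ^ 7 * (X - C ((11 - C s) * C h ^ 3)) ^ 3 := by
      simp [hf, map_ofNat C]
    have hg' : g.map C = (X ^ 2 - 2 * X + C ((11 - C s) * C h ^ 4)) ^ 8 *
        (X ^ 3 - 2 * X ^ 2 + C ((C s + 21) * C h ^ 4) * X + C ((-3 * C s - 31) * C h ^ 7)) ^ 4 *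
          (X - C ((3 - C s) * C h ^ 3)) := by
      simp [hg, map_ofNat C]
    rw [Polynomial.map_mul (p := C c), map_C, ← mul_assoc, ← C_mul (a := X), mul_comm X, hf', hg',
      coverPoly]
  have hirr := irreducible_map_sub_C_mul_map (fun h => h₀ (by rw [h, eval_zero])) hcop
  rw [← hP, (natDegree_and_monic_coverPoly _ _ _).2.irreducible_iff_irreducible_map_fraction_map
    (K := RatFunc K), map_coverPoly] at hirr
  simpa using hirr

end Irreducibility

section RootsModPrimes

lemma simpleRoots_pointRoots : ∀ n ∈ List.range 32, n ≠ 0 →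
    ((9587 : ℕ) : ℤ) ∣ (coverPoly (4664 : ℤ) 4794 8698).eval (pointRoots.getD n 0 : ℤ) ∧
      ¬ ((9587 : ℕ) : ℤ) ∣
        (derivative (coverPoly (4664 : ℤ) 4794 8698)).eval (pointRoots.getD n 0 : ℤ) := by
  simp only [eval_coverPoly, eval_derivative_coverPoly]
  decide +kernel

lemma simpleRoots_hyperplaneRoots : ∀ n ∈ List.range 32, n ≠ 0 →
    ((9587 : ℕ) : ℤ) ∣
        (coverPoly (-4664 : ℤ) 4794 ((31 - 3 * 4664) * 4794 ^ 5 * 8698)).eval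
          (hyperplaneRoots.getD n 0 : ℤ) ∧
      ¬ ((9587 : ℕ) : ℤ) ∣ (derivative
        (coverPoly (-4664 : ℤ) 4794 ((31 - 3 * 4664) * 4794 ^ 5 * 8698))).eval
          (hyperplaneRoots.getD n 0 : ℤ) := by
  simp only [eval_coverPoly, eval_derivative_coverPoly]
  decide +kernel

lemma pointRoots_injOn : ∀ m ∈ List.range 32, ∀ n ∈ List.range 32,
    pointRoots.getD m 0 % 9587 = pointRoots.getD n 0 % 9587 → m = n := by
  decide +kernel

lemma hyperplaneRoots_injOn : ∀ m ∈ List.range 32, ∀ n ∈ List.range 32,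
    hyperplaneRoots.getD m 0 % 9587 = hyperplaneRoots.getD n 0 % 9587 → m = n := by
  decide +kernel

/-- The roots over `614` modulo `967`. -/
def partialRoots : List ℕ :=
  [18, 48, 74, 231, 391, 425, 462, 491, 576, 597, 635, 643, 667, 713, 911]

lemma simpleRoots_partialRoots : ∀ n ∈ partialRoots,
    ((967 : ℕ) : ℤ) ∣ (coverPoly (432 : ℤ) 484 614).eval (n : ℤ) ∧
      ¬ ((967 : ℕ) : ℤ) ∣ (derivative (coverPoly (432 : ℤ) 484 614)).eval (n : ℤ) := by
  simp only [eval_coverPoly, eval_derivative_coverPoly]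
  decide +kernel

lemma mem_partialRoots : ∀ n ∈ List.range 967,
    ((967 : ℕ) : ℤ) ∣ (coverPoly (432 : ℤ) 484 614).eval (n : ℤ) → n ∈ partialRoots := by
  simp only [eval_coverPoly]
  decide +kernel

lemma nodup_partialRoots : (partialRoots.map ((↑) : ℕ → ZMod 967)).Nodup := by
  decide +kernel

end RootsModPrimes

section Indexing

open Matrix

/-- The number whose binary digits are the coordinates of a vector over `𝔽₂`. -/
def bitIndex (v : Fin 5 → ZMod 2) : ℕ :=
  (v 0).val + 2 * (v 1).val + 4 * (v 2).val + 8 * (v 3).val + 16 * (v 4).val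

lemma bitIndex_injective : Function.Injective bitIndex := by
  intro v w h
  have hv := fun i => (v i).val_lt
  have hw := fun i => (w i).val_lt
  have hv0 := hv 0
  have hv1 := hv 1
  have hv2 := hv 2
  have hv3 := hv 3
  have hv4 := hv 4
  have hw0 := hw 0
  have hw1 := hw 1
  have hw2 := hw 2
  have hw3 := hw 3
  have hw4 := hw 4
  simp only [bitIndex] at h
  funext i
  apply ZMod.val_injective
  fin_cases i <;> simp <;> omega

lemma bitIndex_lt (v : Fin 5 → ZMod 2) : bitIndex v < 32 := by
  have hv := fun i => (v i).val_lt
  have hv0 := hv 0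
  have hv1 := hv 1
  have hv2 := hv 2
  have hv3 := hv 3
  have hv4 := hv 4
  rw [bitIndex]
  omega

lemma bitIndex_ne_zero {v : Fin 5 → ZMod 2} (hv : v ≠ 0) : bitIndex v ≠ 0 := fun h =>
  hv (bitIndex_injective (h.trans (by simp [bitIndex])))

lemma bitPairing_bitIndex (v w : Fin 5 → ZMod 2) :
    bitPairing (bitIndex v) (bitIndex w) = 0 ↔ v ⬝ᵥ w = 0 := by
  have hdigit : ∀ u : Fin 5 → ZMod 2, bitIndex u % 2 = (u 0).val ∧
      bitIndex u / 2 % 2 = (u 1).val ∧ bitIndex u / 4 % 2 = (u 2).val ∧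
      bitIndex u / 8 % 2 = (u 3).val ∧ bitIndex u / 16 % 2 = (u 4).val := by
    intro u
    have hu := fun i => (u i).val_lt
    have hu0 := hu 0
    have hu1 := hu 1
    have hu2 := hu 2
    have hu3 := hu 3
    have hu4 := hu 4
    rw [bitIndex]
    omega
  obtain ⟨h0, h1, h2, h3, h4⟩ := hdigit v
  obtain ⟨k0, k1, k2, k3, k4⟩ := hdigit w
  rw [bitPairing, h0, h1, h2, h3, h4, k0, k1, k2, k3, k4, ← Nat.dvd_iff_mod_eq_zero,
    ← ZMod.natCast_eq_zero_iff]
  simp [dotProduct, Fin.sum_univ_five]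

lemma card_nonzero_vectors : Fintype.card {v : Fin 5 → ZMod 2 // v ≠ 0} = 31 := by
  rw [Fintype.card_subtype_compl, Fintype.card_subtype_eq]
  simp

end Indexing

section PadicEmbedding

variable {l : ℕ} [Fact l.Prime]

lemma exists_isRoot_toZMod_eq {P : ℤ_[l][X]} (hP : P.Monic) {a : ZMod l}
    (h : (P.map PadicInt.toZMod).eval a = 0)
    (h' : (derivative (P.map PadicInt.toZMod)).eval a ≠ 0) :
    ∃ z : ℤ_[l], P.eval z = 0 ∧ PadicInt.toZMod z = a := by
  have ha : PadicInt.toZMod (a.val : ℤ_[l]) = a := by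
    rw [map_natCast, ZMod.natCast_zmod_val]
  rw [derivative_map] at h'
  rw [← ha, eval_map_apply] at h h'
  obtain ⟨z, hz, hza⟩ := HenselianRing.is_henselian (I := IsLocalRing.maximalIdeal ℤ_[l]) P hP
    (a.val : ℤ_[l]) (by rwa [← PadicInt.ker_toZMod, RingHom.mem_ker]) (by
      refine IsUnit.map _ (of_not_not fun hu => h' ?_)
      rwa [← RingHom.mem_ker, PadicInt.ker_toZMod, IsLocalRing.mem_maximalIdeal])
  rw [← PadicInt.ker_toZMod, RingHom.mem_ker, map_sub, sub_eq_zero, ha] at hza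
  exact ⟨z, hz, hza⟩

lemma exists_transcendental_toZMod_eq {K : Type*} [Field K] [Countable K] [Algebra K ℚ_[l]]
    (b : ZMod l) :
    ∃ T : ℤ_[l], Transcendental K (T : ℚ_[l]) ∧ PadicInt.toZMod T = b := by
  have hd := (Algebraic.countable K ℚ_[l]).dense_compl ℚ_[l]
  obtain ⟨x, hx, hxT⟩ := hd.exists_mem_open (Metric.isOpen_ball (x := ((b.val : ℤ_[l]) : ℚ_[l]))
    (ε := 1)) ⟨_, Metric.mem_ball_self one_pos⟩
  have hx' : ‖x - ((b.val : ℤ_[l]) : ℚ_[l])‖ < 1 := by rwa [Metric.mem_ball, dist_eq_norm] at hxT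
  have hx1 : ‖x‖ ≤ 1 := by
    have := Padic.nonarchimedean (x - ((b.val : ℤ_[l]) : ℚ_[l])) ((b.val : ℤ_[l]) : ℚ_[l])
    rw [sub_add_cancel] at this
    exact this.trans (max_le hx'.le (PadicInt.norm_le_one _))
  obtain ⟨T, rfl⟩ : ∃ T : ℤ_[l], (T : ℚ_[l]) = x := ⟨⟨x, hx1⟩, rfl⟩
  refine ⟨T, hx, ?_⟩
  have hmem : T - (b.val : ℤ_[l]) ∈ IsLocalRing.maximalIdeal ℤ_[l] := by
    rw [IsLocalRing.mem_maximalIdeal, PadicInt.mem_nonunits]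
    rw [PadicInt.norm_def, PadicInt.coe_sub, PadicInt.coe_natCast]
    rwa [PadicInt.coe_natCast] at hx'
  rw [← PadicInt.ker_toZMod, RingHom.mem_ker, map_sub, sub_eq_zero, map_natCast,
    ZMod.natCast_zmod_val] at hmem
  exact hmem

/-- The field `ℚ(√-7)(t)` embeds into `ℚ_l` with prescribed reductions of `√-7` and `t`. -/
theorem exists_padic_embedding {K : Type*} [Field K] [Algebra ℚ K] {s : K} (hs : s ^ 2 = -7)
    (hgen : Algebra.adjoin ℚ ({s} : Set K) = ⊤) {a : ZMod l} (b : ZMod l) (ha : a ^ 2 = -7)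
    (ha' : 2 * a ≠ 0) :
    ∃ (ι : RatFunc K →+* ℚ_[l]) (S H T : ℤ_[l]), S ^ 2 = -7 ∧ 2 * H = 1 ∧
      ι (RatFunc.C s) = S ∧ ι (RatFunc.X) = T ∧ PadicInt.toZMod S = a ∧
        PadicInt.toZMod T = b := by
  obtain ⟨S, hS, hSa⟩ : ∃ S : ℤ_[l], S ^ 2 = -7 ∧ PadicInt.toZMod S = a := by
    obtain ⟨S, hS, hSa⟩ := exists_isRoot_toZMod_eq (l := l) (P := X ^ 2 + C 7) (a := a)
      (monic_X_pow_add_C 7 two_ne_zero) (by simp [ha, map_ofNat PadicInt.toZMod])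
      (by simpa [one_add_one_eq_two] using ha')
    exact ⟨S, by simpa [add_eq_zero_iff_eq_neg] using hS, hSa⟩
  obtain ⟨H, hH⟩ : ∃ H : ℤ_[l], 2 * H = 1 := by
    have : IsUnit (2 : ℤ_[l]) := of_not_not fun hu => left_ne_zero_of_mul ha' (by
      change (2 : ℤ_[l]) ∈ nonunits _ at hu
      rwa [← IsLocalRing.mem_maximalIdeal, ← PadicInt.ker_toZMod, RingHom.mem_ker, map_ofNat]
        at hu)
    exact this.exists_right_inv
  have hirr : Irreducible (X ^ 2 + C 7 : ℚ[X]) := by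
    refine (irreducible_iff_roots_eq_zero_of_degree_le_three ?_ ?_).mpr ?_
    · rw [natDegree_X_pow_add_C]
    · rw [natDegree_X_pow_add_C]; norm_num
    · refine Multiset.eq_zero_of_forall_notMem fun r hr => ?_
      have := (mem_roots'.mp hr).2
      simp at this
      nlinarith
  have : Fact (Irreducible (X ^ 2 + C 7 : ℚ[X])) := ⟨hirr⟩
  let f : AdjoinRoot (X ^ 2 + C 7 : ℚ[X]) →+* K := AdjoinRoot.lift (algebraMap ℚ K) s (by simp [hs])
  have hf : Function.Surjective f := by
    intro x
    have hx : x ∈ Algebra.adjoin ℚ {s} := hgen ▸ Algebra.mem_top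
    rw [Algebra.adjoin_singleton_eq_range_aeval] at hx
    obtain ⟨g, rfl⟩ := hx
    exact ⟨AdjoinRoot.mk _ g, by simp [f, aeval_def]⟩
  let j : K →+* ℚ_[l] := (AdjoinRoot.lift (algebraMap ℚ ℚ_[l]) (S : ℚ_[l]) (by
    have := congrArg PadicInt.Coe.ringHom hS
    rw [map_pow, map_neg, map_ofNat] at this
    rw [eval₂_add, eval₂_X_pow, eval₂_C, map_ofNat]
    exact add_eq_zero_iff_eq_neg.mpr this)).comp
      (RingEquiv.ofBijective f ⟨f.injective, hf⟩).symm.toRingHom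
  have hj : j s = S := by
    have hroot : f (AdjoinRoot.root (X ^ 2 + C 7)) = s := by simp [f]
    have : (RingEquiv.ofBijective f ⟨f.injective, hf⟩).symm s = AdjoinRoot.root _ := by
      rw [RingEquiv.symm_apply_eq]
      exact hroot.symm
    simp [j, this]
  have hcount : Countable K := by
    have : Countable ℚ[X] := by
      rw [← Cardinal.mk_le_aleph0_iff]
      exact cardinalMk_le_max.trans (by simp)
    exact (hf.comp AdjoinRoot.mk_surjective).countable
  let : Algebra K ℚ_[l] := j.toAlgebra
  obtain ⟨T, hT, hTb⟩ := exists_transcendental_toZMod_eq (K := K) b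
  have hinj : Function.Injective (aeval (R := K) (T : ℚ_[l])) :=
    transcendental_iff_injective.mp hT
  refine ⟨IsFractionRing.lift (g := (aeval (R := K) (T : ℚ_[l])).toRingHom) hinj, S, H, T, hS, hH,
    ?_, ?_, hSa, hTb⟩
  · rw [← RatFunc.algebraMap_C, IsFractionRing.lift_algebraMap]
    exact (aeval_C _ _).trans hj
  · rw [← RatFunc.algebraMap_X, IsFractionRing.lift_algebraMap]
    simp

end PadicEmbedding

section PadicSplitting

variable {l : ℕ} [Fact l.Prime]

lemma exists_roots_toZMod_eq {P : ℤ_[l][X]} (hP : P.Monic) {V : Type*} (r : V → ZMod l)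
    (h : ∀ v, (P.map PadicInt.toZMod).eval (r v) = 0)
    (h' : ∀ v, (derivative (P.map PadicInt.toZMod)).eval (r v) ≠ 0) :
    ∃ z : V → ℤ_[l], ∀ v, P.eval (z v) = 0 ∧ PadicInt.toZMod (z v) = r v :=
  Classical.skolem.mp fun v => exists_isRoot_toZMod_eq hP (h v) (h' v)

lemma coe_mem_rootSet {F : Type*} [Field F] [Algebra F ℚ_[l]] {p : F[X]} {P : ℤ_[l][X]}
    (hP : P.Monic) (hp : p.map (algebraMap F ℚ_[l]) = P.map PadicInt.Coe.ringHom) {z : ℤ_[l]}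
    (hz : P.eval z = 0) : (z : ℚ_[l]) ∈ p.rootSet ℚ_[l] := by
  have h0 : p.map (algebraMap F ℚ_[l]) ≠ 0 := hp ▸ (hP.map _).ne_zero
  refine mem_rootSet.mpr ⟨fun h => h0 (by rw [h, Polynomial.map_zero]), ?_⟩
  have : PadicInt.Coe.ringHom (P.eval z) = 0 := by rw [hz, map_zero]
  rwa [← eval_map_apply, ← hp, eval_map_algebraMap] at this

/-- A monic polynomial over `ℤ_l` with as many simple roots modulo `l` as its degree splits, and
its roots are indexed by their reductions. -/
theorem splits_and_exists_equiv_rootSet {F : Type*} [Field F] [Algebra F ℚ_[l]] {p : F[X]}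
    {P : ℤ_[l][X]} (hP : P.Monic) (hp : p.map (algebraMap F ℚ_[l]) = P.map PadicInt.Coe.ringHom)
    {V : Type*} [Fintype V] (hV : P.natDegree ≤ Fintype.card V) {r : V → ZMod l}
    (hr : Function.Injective r) (h : ∀ v, (P.map PadicInt.toZMod).eval (r v) = 0)
    (h' : ∀ v, (derivative (P.map PadicInt.toZMod)).eval (r v) ≠ 0) :
    (p.map (algebraMap F ℚ_[l])).Splits ∧
      ∃ (e : V ≃ p.rootSet ℚ_[l]) (z : V → ℤ_[l]), ∀ v,
        (e v : ℚ_[l]) = z v ∧ P.eval (z v) = 0 ∧ PadicInt.toZMod (z v) = r v := by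
  obtain ⟨z, hz⟩ := exists_roots_toZMod_eq hP r h h'
  let f : V → p.rootSet ℚ_[l] := fun v => ⟨z v, coe_mem_rootSet hP hp (hz v).1⟩
  have hf : Function.Injective f := by
    intro v w hvw
    have : z v = z w := 
      Subtype.coe_injective (congrArg (fun y : p.rootSet ℚ_[l] => (y : ℚ_[l])) hvw)
    exact hr (by rw [← (hz v).2, ← (hz w).2, this])
  have hle : Fintype.card (p.rootSet ℚ_[l]) ≤ (p.map (algebraMap F ℚ_[l])).roots.card := by
    classical
    exact (Fintype.card_coe _).le.trans (Multiset.toFinset_card_le _)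
  have hle' := card_roots' (p.map (algebraMap F ℚ_[l]))
  have hdeg : (p.map (algebraMap F ℚ_[l])).natDegree = P.natDegree := by rw [hp, hP.natDegree_map]
  have hfc := Fintype.card_le_of_injective f hf
  refine ⟨splits_iff_card_roots.mpr (by omega), Equiv.ofBijective f
    ((Fintype.bijective_iff_injective_and_card f).mpr ⟨hf, by omega⟩), z, fun v => ⟨rfl, hz v⟩⟩

lemma exists_finset_subset_rootSet {F : Type*} [Field F] [Algebra F ℚ_[l]] {p : F[X]}
    {P : ℤ_[l][X]} (hP : P.Monic) (hp : p.map (algebraMap F ℚ_[l]) = P.map PadicInt.Coe.ringHom)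
    (S : Finset (ZMod l)) (h : ∀ a ∈ S, (P.map PadicInt.toZMod).eval a = 0)
    (h' : ∀ a ∈ S, (derivative (P.map PadicInt.toZMod)).eval a ≠ 0) :
    ∃ S' : Finset ℚ_[l], (∀ x ∈ S', x ∈ p.rootSet ℚ_[l]) ∧ S'.card = S.card := by
  classical
  obtain ⟨z, hz⟩ := exists_roots_toZMod_eq hP (fun a : S => (a : ZMod l)) (fun a => h a a.2)
    fun a => h' a a.2
  refine ⟨Finset.univ.image fun a => (z a : ℚ_[l]), fun x hx => ?_, ?_⟩
  · obtain ⟨a, -, rfl⟩ := Finset.mem_image.mp hx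
    exact coe_mem_rootSet hP hp (hz a).1
  · rw [Finset.card_image_of_injective, Finset.card_univ, Fintype.card_coe]
    intro a b hab
    have hzab : z a = z b := Subtype.coe_injective hab
    exact Subtype.ext (by rw [← (hz a).2, ← (hz b).2, hzab])

/-- If all roots modulo `l` of a monic polynomial over `ℤ_l` are simple, and there are fewer of
them than the degree, then the polynomial does not split. -/
theorem not_splits_of_card_lt {P : ℤ_[l][X]} (hP : P.Monic) (S : Finset (ZMod l))
    (hS : ∀ a, (P.map PadicInt.toZMod).eval a = 0 → a ∈ S)
    (h' : ∀ a ∈ S, (derivative (P.map PadicInt.toZMod)).eval a ≠ 0) (hcard : S.card < P.natDegree) :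
    ¬ (P.map PadicInt.Coe.ringHom).Splits := by
  intro hs
  have hs' : P.Splits := by
    refine Splits.of_splits_map_of_injective
      (i := PadicInt.Coe.ringHom) Subtype.coe_injective hs fun a ha => ?_
    have hint : IsIntegral ℤ_[l] a := by
      refine ⟨P, hP, ?_⟩
      rw [← eval_map]
      exact (mem_roots'.mp ha).2
    obtain ⟨z, rfl⟩ := IsIntegrallyClosed.isIntegral_iff.mp hint
    exact ⟨z, rfl⟩
  have hs'' := hs'.map PadicInt.toZMod
  have h0 := (hP.map PadicInt.toZMod).ne_zero
  have hsub : (P.map PadicInt.toZMod).roots ≤ S.val := by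
    refine (Multiset.le_iff_subset ?_).mpr fun a ha => hS a (mem_roots'.mp ha).2
    rw [Multiset.nodup_iff_count_le_one]
    intro a
    rw [count_roots]
    by_contra! hlt
    have := (one_lt_rootMultiplicity_iff_isRoot h0).mp hlt
    exact h' a (hS a this.1) this.2
  have := Multiset.card_le_card hsub
  rw [← hs''.natDegree_eq_card_roots, hP.natDegree_map] at this
  exact absurd this (not_le.mpr hcard)

end PadicSplitting

section Specialization

lemma eval_coverPoly_intCast_eq_zero_iff (l : ℕ) (s h t x : ℤ) :
    (coverPoly (s : ZMod l) h t).eval (x : ZMod l) = 0 ↔ (l : ℤ) ∣ (coverPoly s h t).eval x := by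
  rw [← ZMod.intCast_zmod_eq_zero_iff_dvd, ← eq_intCast (Int.castRingHom (ZMod l)) s,
    ← eq_intCast (Int.castRingHom (ZMod l)) h, ← eq_intCast (Int.castRingHom (ZMod l)) t,
    ← map_coverPoly, eval_intCast_map, eq_intCast, Int.cast_id]

lemma eval_derivative_coverPoly_intCast_eq_zero_iff (l : ℕ) (s h t x : ℤ) :
    (derivative (coverPoly (s : ZMod l) h t)).eval (x : ZMod l) = 0 ↔
      (l : ℤ) ∣ (derivative (coverPoly s h t)).eval x := by
  rw [← ZMod.intCast_zmod_eq_zero_iff_dvd, ← eq_intCast (Int.castRingHom (ZMod l)) s,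
    ← eq_intCast (Int.castRingHom (ZMod l)) h, ← eq_intCast (Int.castRingHom (ZMod l)) t,
    ← map_coverPoly, derivative_map, eval_intCast_map, eq_intCast, Int.cast_id]

/-- A specialisation of the cover over the `967`-adic numbers with exactly fifteen roots. -/
lemma not_splits_coverPoly_and_exists_finset [Fact (Nat.Prime 967)]
    {F : Type*} [Field F] [Algebra F ℚ_[967]] {p : F[X]} {S H T : ℤ_[967]}
    (hp : p.map (algebraMap F ℚ_[967]) = (coverPoly S H T).map PadicInt.Coe.ringHom)
    (hS : PadicInt.toZMod S = (432 : ℤ)) (hH : PadicInt.toZMod H = (484 : ℤ))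
    (hT : PadicInt.toZMod T = (614 : ℤ)) :
    ¬ (p.map (algebraMap F ℚ_[967])).Splits ∧
      ∃ R : Finset ℚ_[967], (∀ x ∈ R, x ∈ p.rootSet ℚ_[967]) ∧ R.card = 15 := by
  obtain ⟨hdeg, hmonic⟩ := natDegree_and_monic_coverPoly S H T
  have hmap : (coverPoly S H T).map PadicInt.toZMod =
      coverPoly ((432 : ℤ) : ZMod 967) (484 : ℤ) (614 : ℤ) := by
    rw [map_coverPoly, hS, hH, hT]
  let R : Finset (ZMod 967) := (partialRoots.map ((↑) : ℕ → ZMod 967)).toFinset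
  have hR : R.card = 15 := by
    rw [List.toFinset_card_of_nodup nodup_partialRoots, List.length_map]
    rfl
  have hmem : ∀ a ∈ R, ((coverPoly S H T).map PadicInt.toZMod).eval a = 0 ∧
      (derivative ((coverPoly S H T).map PadicInt.toZMod)).eval a ≠ 0 := by
    intro a ha
    obtain ⟨n, hn, rfl⟩ := List.mem_map.mp (List.mem_toFinset.mp ha)
    rw [hmap, ← Int.cast_natCast, eval_coverPoly_intCast_eq_zero_iff, Ne,
      eval_derivative_coverPoly_intCast_eq_zero_iff]
    exact simpleRoots_partialRoots n hn
  refine ⟨?_, ?_⟩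
  · rw [hp]
    refine not_splits_of_card_lt hmonic R (fun a ha => ?_) (fun a ha => (hmem a ha).2)
      (by rw [hR, hdeg]; norm_num)
    rw [hmap, ← ZMod.natCast_zmod_val a, ← Int.cast_natCast,
      eval_coverPoly_intCast_eq_zero_iff] at ha
    exact List.mem_toFinset.mpr (List.mem_map.mpr ⟨a.val, mem_partialRoots _
      (List.mem_range.mpr a.val_lt) ha, ZMod.natCast_zmod_val a⟩)
  · rw [← hR]
    exact exists_finset_subset_rootSet hmonic hp R (fun a ha => (hmem a ha).1)
      fun a ha => (hmem a ha).2

variable [Fact (Nat.Prime 9587)]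

/-- A specialisation of the cover that splits completely over the `9587`-adic numbers. -/
lemma splits_coverPoly_and_exists_equiv {F : Type*} [Field F] [Algebra F ℚ_[9587]] {p : F[X]}
    {S H T : ℤ_[9587]}
    (hp : p.map (algebraMap F ℚ_[9587]) = (coverPoly S H T).map PadicInt.Coe.ringHom)
    {a b c : ℤ} (hS : PadicInt.toZMod S = a) (hH : PadicInt.toZMod H = b)
    (hT : PadicInt.toZMod T = c) {u : List ℕ}
    (hu : ∀ n ∈ List.range 32, n ≠ 0 →
      ((9587 : ℕ) : ℤ) ∣ (coverPoly a b c).eval (u.getD n 0 : ℤ) ∧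
        ¬ ((9587 : ℕ) : ℤ) ∣ (derivative (coverPoly a b c)).eval (u.getD n 0 : ℤ))
    (hinj : ∀ m ∈ List.range 32, ∀ n ∈ List.range 32,
      u.getD m 0 % 9587 = u.getD n 0 % 9587 → m = n) :
    (p.map (algebraMap F ℚ_[9587])).Splits ∧
      ∃ (e : {v : Fin 5 → ZMod 2 // v ≠ 0} ≃ p.rootSet ℚ_[9587])
        (z : {v : Fin 5 → ZMod 2 // v ≠ 0} → ℤ_[9587]), ∀ v,
        (e v : ℚ_[9587]) = z v ∧ (coverPoly S H T).eval (z v) = 0 ∧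
          PadicInt.toZMod (z v) = (u.getD (bitIndex v.1) 0 : ℕ) := by
  obtain ⟨hdeg, hmonic⟩ := natDegree_and_monic_coverPoly S H T
  have hmap : (coverPoly S H T).map PadicInt.toZMod = coverPoly (a : ZMod 9587) b c := by
    rw [map_coverPoly, hS, hH, hT]
  have hu' := fun v : {v : Fin 5 → ZMod 2 // v ≠ 0} =>
    hu (bitIndex v.1) (List.mem_range.mpr (bitIndex_lt _)) (bitIndex_ne_zero v.2)
  refine splits_and_exists_equiv_rootSet hmonic hp (by rw [hdeg, card_nonzero_vectors])
    (fun v w hvw => ?_) (fun v => ?_) fun v => ?_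
  · exact Subtype.ext (bitIndex_injective (hinj _ (List.mem_range.mpr (bitIndex_lt _)) _
      (List.mem_range.mpr (bitIndex_lt _)) ((ZMod.natCast_eq_natCast_iff' _ _ _).mp hvw)))
  · rw [hmap, ← Int.cast_natCast, eval_coverPoly_intCast_eq_zero_iff]
    exact (hu' v).1
  · rw [hmap, ← Int.cast_natCast, Ne, eval_derivative_coverPoly_intCast_eq_zero_iff]
    exact (hu' v).2

lemma evalTable_ne_zero_of_horner_ne_zero {S x y : ℤ_[9587]} {a m n : ℕ}
    (hS : PadicInt.toZMod S = a) (hx : PadicInt.toZMod x = n) (hy : PadicInt.toZMod y = m)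
    {u : List (List (ℤ × ℤ))} (h : horner 9587 n (partialEval 9587 a m u) ≠ 0) :
    evalTable S x y u ≠ 0 := by
  intro h0
  have h1 := congrArg PadicInt.toZMod h0
  rw [map_evalTable, hS, hx, hy, ← cast_horner_partialEval, map_zero, ZMod.natCast_eq_zero_iff]
    at h1
  exact h (Nat.eq_zero_of_dvd_of_lt h1 (horner_lt (by norm_num) _ _))

/-- The vanishing of the incidence polynomial is the incidence of points and hyperplanes of the
projective space of dimension four over `𝔽₂`. -/
lemma evalTable_incidenceTable_eq_zero_iff {S H T x y : ℤ_[9587]} (hH : 2 * H = 1)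
    (hS : S ^ 2 = -7) (hSa : PadicInt.toZMod S = (4664 : ℕ))
    (hx : (coverPoly S H T).eval x = 0)
    (hy : (coverPoly (-S) H ((31 - 3 * S) * H ^ 5 * T)).eval y = 0) {v w : Fin 5 → ZMod 2}
    (hv : v ≠ 0) (hw : w ≠ 0)
    (hxv : PadicInt.toZMod x = (pointRoots.getD (bitIndex v) 0 : ℕ))
    (hyw : PadicInt.toZMod y = (hyperplaneRoots.getD (bitIndex w) 0 : ℕ)) :
    evalTable S x y incidenceTable = 0 ↔ bitPairing (bitIndex w) (bitIndex v) = 0 := by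
  have hA := List.all_eq_true.mp (List.all_eq_true.mp horner_incidenceTable_ne_zero _
    (List.mem_range.mpr (bitIndex_lt w))) _ (List.mem_range.mpr (bitIndex_lt v))
  have hB := List.all_eq_true.mp (List.all_eq_true.mp horner_nonincidenceTable_ne_zero _
    (List.mem_range.mpr (bitIndex_lt w))) _ (List.mem_range.mpr (bitIndex_lt v))
  simp only [Bool.or_eq_true, beq_iff_eq, bne_iff_ne, bitIndex_ne_zero hv, bitIndex_ne_zero hw,
    false_or] at hA hB
  constructor
  · intro h0
    exact hA.resolve_right fun h => evalTable_ne_zero_of_horner_ne_zero hSa hxv hyw h h0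
  · intro h0
    have hB' := hB.resolve_left (by rw [h0]; exact zero_ne_one)
    exact (mul_eq_zero.mp (incidence_mul_nonincidence_of_root hH hS hx hy)).resolve_right
      (evalTable_ne_zero_of_horner_ne_zero hSa hxv hyw hB')

end Specialization

section SpecializedGalois

open Matrix

lemma coverPoly_congr {R : Type*} [CommRing R] {s h t s' h' t' : R} (hs : s = s') (hh : h = h')
    (ht : t = t') : coverPoly s h t = coverPoly s' h' t' := by
  rw [hs, hh, ht]

lemma toZMod_eq_of_two_mul {l : ℕ} [Fact l.Prime] {H : ℤ_[l]} (hH : 2 * H = 1) {b : ZMod l}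
    (hb : 2 * b = 1) : PadicInt.toZMod H = b := by
  have h := congrArg PadicInt.toZMod hH
  rw [map_mul, map_ofNat, map_one] at h
  calc PadicInt.toZMod H = 2 * b * PadicInt.toZMod H := by rw [hb, one_mul]
    _ = 2 * PadicInt.toZMod H * b := by ring
    _ = b := by rw [h, one_mul]

theorem nonempty_gal_coverPoly_mulEquiv {K : Type*} [Field K] [Algebra ℚ K] {s h : K}
    (hs : s ^ 2 = -7) (hh : 2 * h = 1) (hgen : Algebra.adjoin ℚ ({s} : Set K) = ⊤) :
    Nonempty ((coverPoly (RatFunc.C s) (RatFunc.C h) RatFunc.X).Gal ≃* GL (Fin 5) (ZMod 2)) := by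
  have hs₁ : ((4664 : ℤ) : ZMod 9587) ^ 2 = -7 ∧ 2 * ((4664 : ℤ) : ZMod 9587) ≠ 0 ∧
      2 * ((4794 : ℤ) : ZMod 9587) = 1 := by decide +kernel
  have hs₂ : ((432 : ℤ) : ZMod 967) ^ 2 = -7 ∧ 2 * ((432 : ℤ) : ZMod 967) ≠ 0 ∧
      2 * ((484 : ℤ) : ZMod 967) = 1 := by decide +kernel
  have : CharZero K := algebraRat.charZero K
  have : Fact (Nat.Prime 9587) := ⟨by norm_num⟩
  have : Fact (Nat.Prime 967) := ⟨by norm_num⟩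
  have hc : (31 - 3 * s) * h ^ 5 ≠ 0 := by
    refine mul_ne_zero (fun h0 => ?_) (pow_ne_zero 5 (right_ne_zero_of_mul (hh ▸ one_ne_zero)))
    have : (1024 : K) = 0 := by linear_combination (31 + 3 * s) * h0 + 9 * hs
    norm_num at this
  have hp := irreducible_coverPoly hh hs (one_ne_zero (α := K))
  rw [map_one, one_mul] at hp
  have hq := irreducible_coverPoly hh (s := -s) (by rw [neg_sq, hs]) hc
  have hι : ∀ {l : ℕ} [Fact l.Prime] (ι : RatFunc K →+* ℚ_[l]) {H : ℤ_[l]}, 2 * H = 1 →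
      ι (RatFunc.C h) = H := by
    intro l _ ι H hH
    have h1 := congrArg (fun x => ι (RatFunc.C x)) hh
    have h2 := congrArg PadicInt.Coe.ringHom hH
    simp only [map_mul, map_ofNat, map_one] at h1 h2
    exact mul_left_cancel₀ two_ne_zero (h1.trans h2.symm)
  obtain ⟨ι₁, S₁, H₁, T₁, hS₁, hH₁, hιS₁, hιT₁, hSa₁, hTb₁⟩ :=
    exists_padic_embedding (l := 9587) hs hgen (a := (4664 : ℤ)) (8698 : ℤ) hs₁.1 hs₁.2.1
  obtain ⟨ι₂, S₂, H₂, T₂, hS₂, hH₂, hιS₂, hιT₂, hSa₂, hTb₂⟩ :=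
    exists_padic_embedding (l := 967) hs hgen (a := (432 : ℤ)) (614 : ℤ) hs₂.1 hs₂.2.1
  have hHb₁ : PadicInt.toZMod H₁ = (4794 : ℤ) := toZMod_eq_of_two_mul hH₁ hs₁.2.2
  have hHb₂ : PadicInt.toZMod H₂ = (484 : ℤ) := toZMod_eq_of_two_mul hH₂ hs₂.2.2
  let : Algebra (RatFunc K) ℚ_[9587] := ι₁.toAlgebra
  let : Algebra (RatFunc K) ℚ_[967] := ι₂.toAlgebra
  obtain ⟨hp₁, e, x, hx⟩ := splits_coverPoly_and_exists_equiv
    (p := coverPoly (RatFunc.C s) (RatFunc.C h) RatFunc.X) (S := S₁) (H := H₁) (T := T₁)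
    (by rw [map_coverPoly, map_coverPoly]; exact coverPoly_congr hιS₁ (hι ι₁ hH₁) hιT₁)
    hSa₁ hHb₁ hTb₁ simpleRoots_pointRoots pointRoots_injOn
  obtain ⟨hq₁, e', y, hy⟩ := splits_coverPoly_and_exists_equiv
    (p := coverPoly (RatFunc.C (-s)) (RatFunc.C h) (RatFunc.C ((31 - 3 * s) * h ^ 5) * RatFunc.X))
    (S := -S₁) (H := H₁) (T := (31 - 3 * S₁) * H₁ ^ 5 * T₁)
    (a := -4664) (c := (31 - 3 * 4664) * 4794 ^ 5 * 8698)
    (by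
      rw [map_coverPoly, map_coverPoly]
      refine coverPoly_congr ?_ (hι ι₁ hH₁) ?_
      · rw [map_neg, map_neg, map_neg]
        exact congrArg Neg.neg hιS₁
      · have hS : algebraMap (RatFunc K) ℚ_[9587] (RatFunc.C s) = PadicInt.Coe.ringHom S₁ := hιS₁
        have hH : algebraMap (RatFunc K) ℚ_[9587] (RatFunc.C h) = PadicInt.Coe.ringHom H₁ :=
          hι ι₁ hH₁
        have hT : algebraMap (RatFunc K) ℚ_[9587] RatFunc.X = PadicInt.Coe.ringHom T₁ := hιT₁
        simp only [map_mul, map_sub, map_pow, map_ofNat, hS, hH, hT])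
    (by rw [map_neg, hSa₁]; push_cast; rfl) hHb₁
    (by
      rw [map_mul, map_mul, map_sub, map_mul, map_pow, hSa₁, hHb₁, hTb₁, map_ofNat, map_ofNat]
      simp only [Int.cast_mul, Int.cast_sub, Int.cast_pow, Int.cast_ofNat])
    simpleRoots_hyperplaneRoots hyperplaneRoots_injOn
  obtain ⟨hp₂, R, hR, hRcard⟩ := not_splits_coverPoly_and_exists_finset
    (p := coverPoly (RatFunc.C s) (RatFunc.C h) RatFunc.X) (S := S₂) (H := H₂) (T := T₂)
    (by rw [map_coverPoly, map_coverPoly]; exact coverPoly_congr hιS₂ (hι ι₂ hH₂) hιT₂)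
    hSa₂ hHb₂ hTb₂
  refine nonempty_gal_mulEquiv_generalLinearGroup hp hq (by decide) (RatFunc.C s) incidenceTable
    hp₁ hq₁ e e' (fun v w => ?_) hp₂ R hR (by rw [hRcard]; norm_num)
  have hS : algebraMap (RatFunc K) ℚ_[9587] (RatFunc.C s) = PadicInt.Coe.ringHom S₁ := hιS₁
  have hev : (e v : ℚ_[9587]) = PadicInt.Coe.ringHom (x v) := (hx v).1
  have hew : (e' w : ℚ_[9587]) = PadicInt.Coe.ringHom (y w) := (hy w).1
  rw [hS, hev, hew, ← map_evalTable, map_eq_zero_iff _ Subtype.coe_injective,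
    evalTable_incidenceTable_eq_zero_iff hH₁ hS₁ (by rw [hSa₁]; rfl) (hx v).2.1 (hy w).2.1 v.2 w.2
      (hx v).2.2 (hy w).2.2, bitPairing_bitIndex]

end SpecializedGalois

/-- Let `K = ℚ(√−7)` and set `a₁ = (−√−7 + 11)/8`, `a₂ = (−√−7 + 11)/16`,
`a₃ = (√−7 + 21)/16`, `a₄ = (−3√−7 − 31)/128`, `a₅ = (−√−7 + 3)/8`. Then the polynomial
`p(x) = x²¹(x−1)⁷(x−a₁)³ − t(x²−2x+a₂)⁸(x³−2x²+a₃x+a₄)⁴(x−a₅)`, of degree 31 in `x`, has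
Galois group over `K(t)` isomorphic to `PSL₅(𝔽₂)`, the projective special linear group of
degree 5 over the field with two elements. -/
theorem galoisGroup_threePointCover_eq_PSL52
    (K : Type*) [Field K] [Algebra ℚ K] (s : K) (hs : s ^ 2 = -7)
    (hgen : Algebra.adjoin ℚ ({s} : Set K) = ⊤) :
    ∀ a1 a2 a3 a4 a5 : RatFunc K,
      a1 = RatFunc.C ((-s + 11) / 8) →
      a2 = RatFunc.C ((-s + 11) / 16) →
      a3 = RatFunc.C ((s + 21) / 16) →
      a4 = RatFunc.C ((-3 * s - 31) / 128) →
      a5 = RatFunc.C ((-s + 3) / 8) →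
      ∀ p : Polynomial (RatFunc K),
        p = X^21 * (X - 1)^7 * (X - C a1)^3
            - C RatFunc.X * (X^2 - 2*X + C a2)^8 * (X^3 - 2*X^2 + C a3 * X + C a4)^4
                * (X - C a5) →
        p.natDegree = 31 ∧
        Nonempty (p.Gal ≃* Matrix.ProjectiveSpecialLinearGroup (Fin 5) (ZMod 2)) := by
  rintro _ _ _ _ _ rfl rfl rfl rfl rfl p rfl
  have : CharZero K := algebraRat.charZero K
  have hp : X ^ 21 * (X - 1) ^ 7 * (X - C (RatFunc.C ((-s + 11) / 8))) ^ 3 -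
      C RatFunc.X * (X ^ 2 - 2 * X + C (RatFunc.C ((-s + 11) / 16))) ^ 8 *
        (X ^ 3 - 2 * X ^ 2 + C (RatFunc.C ((s + 21) / 16)) * X +
          C (RatFunc.C ((-3 * s - 31) / 128))) ^ 4 * (X - C (RatFunc.C ((-s + 3) / 8))) =
      coverPoly (RatFunc.C s) (RatFunc.C (1 / 2)) RatFunc.X := by
    have h1 : RatFunc.C ((-s + 11) / 8) = (11 - RatFunc.C s) * RatFunc.C (1 / 2) ^ 3 := by
      rw [← map_ofNat RatFunc.C 11, ← map_sub, ← map_pow, ← map_mul]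
      congr 1
      ring
    have h2 : RatFunc.C ((-s + 11) / 16) = (11 - RatFunc.C s) * RatFunc.C (1 / 2) ^ 4 := by
      rw [← map_ofNat RatFunc.C 11, ← map_sub, ← map_pow, ← map_mul]
      congr 1
      ring
    have h3 : RatFunc.C ((s + 21) / 16) = (RatFunc.C s + 21) * RatFunc.C (1 / 2) ^ 4 := by
      rw [← map_ofNat RatFunc.C 21, ← map_add, ← map_pow, ← map_mul]
      congr 1
      ring
    have h4 : RatFunc.C ((-3 * s - 31) / 128) =
        (-3 * RatFunc.C s - 31) * RatFunc.C (1 / 2) ^ 7 := by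
      rw [← map_ofNat RatFunc.C 3, ← map_ofNat RatFunc.C 31, ← map_neg, ← map_mul, ← map_sub,
        ← map_pow, ← map_mul]
      congr 1
      ring
    have h5 : RatFunc.C ((-s + 3) / 8) = (3 - RatFunc.C s) * RatFunc.C (1 / 2) ^ 3 := by
      rw [← map_ofNat RatFunc.C 3, ← map_sub, ← map_pow, ← map_mul]
      congr 1
      ring
    rw [coverPoly, h1, h2, h3, h4, h5, mul_assoc (C RatFunc.X), mul_assoc (C RatFunc.X)]
  rw [hp]
  obtain ⟨e⟩ := nonempty_gal_coverPoly_mulEquiv hs (mul_one_div_cancel two_ne_zero) hgen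
  obtain ⟨e'⟩ := nonempty_generalLinearGroup_mulEquiv 5
  exact ⟨(natDegree_and_monic_coverPoly _ _ _).1, ⟨e.trans e'⟩⟩

end PSL52Family
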